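/- Let n ≥ 2 and let f be a real polynomial on ℝ^n with f ≥ 0 of degree m ≥ 2. Then for every ε > 0 there exists a global solution u to the thin obstacle problem (with zero obstacle) in ℝ^{n+1} with polynomial growth (of some order m_ε depending on ε), whose contact set satisfies ({x' : f(x') = 0} × {0}) ∩ B₁ ⊆ Λ(u) ⊆ {(x', 0) ∈ ℝ^{n+1} : dist(x', {f = 0}) ≤ ε} ∩ B_{1+ε}, where B₁ and B_{1+ε} are the balls of radii 1 and 1+ε in ℝ^{n+1} centered at the origin. -/

import Mathlib

open MeasureTheory Metric Set Filter

noncomputable section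

/-- The point `(x', t)` of `ℝ^{n+1}`, where `x' ∈ ℝ^n`. -/
def thinEmbed (n : ℕ) (x' : EuclideanSpace ℝ (Fin n)) (t : ℝ) :
    EuclideanSpace ℝ (Fin (n + 1)) :=
  (EuclideanSpace.equiv (Fin (n + 1)) ℝ).symm (Fin.snoc (fun i => x' i) t)

/-- Projection of a point of `ℝ^{n+1}` to its first `n` coordinates. -/
def thinProj (n : ℕ) (x : EuclideanSpace ℝ (Fin (n + 1))) : EuclideanSpace ℝ (Fin n) :=
  (EuclideanSpace.equiv (Fin n) ℝ).symm (fun i => x i.castSucc)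

/-- The Laplacian of `f : ℝ^d → ℝ`: the sum of pure second partial derivatives. -/
def lapl (d : ℕ) (f : EuclideanSpace ℝ (Fin d) → ℝ) (x : EuclideanSpace ℝ (Fin d)) : ℝ :=
  ∑ i : Fin d,
    fderiv ℝ (fun y => fderiv ℝ f y (EuclideanSpace.single i 1)) x (EuclideanSpace.single i 1)

/-- `f` is harmonic on a set: twice continuously differentiable with vanishing Laplacian. -/
def IsHarmonicOnSet (d : ℕ) (f : EuclideanSpace ℝ (Fin d) → ℝ)
    (s : Set (EuclideanSpace ℝ (Fin d))) : Prop :=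
  ContDiffOn ℝ 2 f s ∧ ∀ x ∈ s, lapl d f x = 0

/-- Super-mean-value property w.r.t. averages over balls
(encodes `Δf ≤ 0` for continuous `f`). -/
def SuperMeanVal (d : ℕ) (f : EuclideanSpace ℝ (Fin d) → ℝ) : Prop :=
  ∀ (x : EuclideanSpace ℝ (Fin d)) (r : ℝ), 0 < r → (⨍ y in Metric.ball x r, f y) ≤ f x

/-- The contact set `Λ_φ(u) = {(x',0) : u(x',0) = φ(x')}`. -/
def contactSet (n : ℕ) (φ : EuclideanSpace ℝ (Fin n) → ℝ)
    (u : EuclideanSpace ℝ (Fin (n + 1)) → ℝ) : Set (EuclideanSpace ℝ (Fin (n + 1))) :=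
  {x | x (Fin.last n) = 0 ∧ u x = φ (thinProj n x)}

/-- Global solution to the thin obstacle problem in `ℝ^{n+1}` with thin obstacle `φ`:
continuous, even in the last variable, above the obstacle on the thin space,
harmonic outside the contact set, and superharmonic (mean value inequality). -/
def IsGlobalSolution (n : ℕ) (φ : EuclideanSpace ℝ (Fin n) → ℝ)
    (u : EuclideanSpace ℝ (Fin (n + 1)) → ℝ) : Prop :=
  Continuous u ∧
  (∀ x' t, u (thinEmbed n x' t) = u (thinEmbed n x' (-t))) ∧
  (∀ x', φ x' ≤ u (thinEmbed n x' 0)) ∧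
  IsHarmonicOnSet (n + 1) u (contactSet n φ u)ᶜ ∧
  SuperMeanVal (n + 1) u

/-- Evaluation of a real polynomial at a point of `ℝ^d`. -/
def pev {d : ℕ} (q : MvPolynomial (Fin d) ℝ) (x : EuclideanSpace ℝ (Fin d)) : ℝ :=
  MvPolynomial.eval (fun i => x i) q

/-- Polynomial growth (of some order). -/
def HasPolyGrowth (d : ℕ) (u : EuclideanSpace ℝ (Fin d) → ℝ) : Prop :=
  ∃ (m : ℕ) (C : ℝ), ∀ x, |u x| ≤ C * (1 + ‖x‖ ^ m)

/-- Polynomial growth of order exactly `m` (and `m` is the smallest such order). -/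
def PolyGrowthOrder (d : ℕ) (u : EuclideanSpace ℝ (Fin d) → ℝ) (m : ℕ) : Prop :=
  (∃ C : ℝ, ∀ x, |u x| ≤ C * (1 + ‖x‖ ^ m)) ∧
  ∀ m' : ℕ, (∃ C : ℝ, ∀ x, |u x| ≤ C * (1 + ‖x‖ ^ m')) → m ≤ m'

/-- The class `𝒫ᵒ_{n+1}`: polynomials `q` even in the last variable such that
`x_{n+1} q(x)` is harmonic and `closure {q(·,0) < 0}` is compact. -/
def MemPo (n : ℕ) (q : MvPolynomial (Fin (n + 1)) ℝ) : Prop :=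
  (∀ x' t, pev q (thinEmbed n x' t) = pev q (thinEmbed n x' (-t))) ∧
  IsHarmonicOnSet (n + 1) (fun x => x (Fin.last n) * pev q x) Set.univ ∧
  IsCompact (closure {x' : EuclideanSpace ℝ (Fin n) | pev q (thinEmbed n x' 0) < 0})

/-- The class `𝒫ᵉ_{n+1}`: harmonic polynomials `p` even in the last variable such that
`closure {p(·,0) < 0}` is compact. -/
def MemPe (n : ℕ) (p : MvPolynomial (Fin (n + 1)) ℝ) : Prop :=
  (∀ x' t, pev p (thinEmbed n x' t) = pev p (thinEmbed n x' (-t))) ∧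
  IsHarmonicOnSet (n + 1) (pev p) Set.univ ∧
  IsCompact (closure {x' : EuclideanSpace ℝ (Fin n) | pev p (thinEmbed n x' 0) < 0})

/-- `f(x) → 0` as `|x| → ∞`. -/
def VanishAtInfty (d : ℕ) (f : EuclideanSpace ℝ (Fin d) → ℝ) : Prop :=
  ∀ ε > 0, ∃ R : ℝ, ∀ x, R ≤ ‖x‖ → |f x| < ε

/-- The embedding of a subset of `ℝ^n` into the thin space of `ℝ^{n+1}`. -/
def thinSet (n : ℕ) (S : Set (EuclideanSpace ℝ (Fin n))) :
    Set (EuclideanSpace ℝ (Fin (n + 1))) :=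
  (fun x' => thinEmbed n x' 0) '' S

/-- The free boundary `Γ(u)`: the boundary in `ℝ^n` of the positivity set, embedded. -/
def freeBoundary (n : ℕ) (u : EuclideanSpace ℝ (Fin (n + 1)) → ℝ) :
    Set (EuclideanSpace ℝ (Fin (n + 1))) :=
  thinSet n (frontier {x' : EuclideanSpace ℝ (Fin n) | 0 < u (thinEmbed n x' 0)})

/-- Negating the `i`-th coordinate of a point of `ℝ^d`. -/
def negCoordAt (d : ℕ) (i : Fin d) (x : EuclideanSpace ℝ (Fin d)) :
    EuclideanSpace ℝ (Fin d) :=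
  (EuclideanSpace.equiv (Fin d) ℝ).symm (Function.update (fun j => x j) i (-(x i)))

/-- The constant `ρ̄(k, n)`, where `κ = k/(n-1)`. -/
def rhoBar (k n : ℕ) : ℝ :=
  ((k : ℝ) / ((n : ℝ) - 1)) ^ (-(1 : ℝ) / (((n : ℝ) - 1) * ((k : ℝ) / ((n : ℝ) - 1) + 1))) *
    (((k : ℝ) / ((n : ℝ) - 1)) ^
        (-((k : ℝ) / ((n : ℝ) - 1)) / ((k : ℝ) / ((n : ℝ) - 1) + 1)) +
      ((k : ℝ) / ((n : ℝ) - 1)) ^ ((1 : ℝ) / ((k : ℝ) / ((n : ℝ) - 1) + 1))) ^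
      (-(1 : ℝ) / (((n : ℝ) - 1) * ((k : ℝ) / ((n : ℝ) - 1))))

/-- The barrier function `g_{A,t}(r) = A r^{1-n} + t - 1 + r^k`. -/
def gfun (n k : ℕ) (A t r : ℝ) : ℝ :=
  A * r ^ ((1 : ℝ) - (n : ℝ)) + t - 1 + r ^ k

open scoped Topology

/-- Euclidean space of dimension `d`. -/
abbrev Euc (d : ℕ) : Type := EuclideanSpace ℝ (Fin d)

section Laplacian

variable {d : ℕ}

/-- The `i`-th coordinate vector. -/
abbrev coordVec (i : Fin d) : Euc d := EuclideanSpace.single i 1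

theorem ContDiffAt.differentiableAt_fderiv_apply {f : Euc d → ℝ} {x : Euc d}
    (hf : ContDiffAt ℝ 2 f x) (v : Euc d) :
    DifferentiableAt ℝ (fun y => fderiv ℝ f y v) x := by
  have h : ContDiffAt ℝ 1 (fderiv ℝ f) x := hf.fderiv_right (by norm_num)
  exact (h.differentiableAt (by norm_num)).clm_apply (differentiableAt_const v)

theorem ContDiffAt.eventually_differentiableAt {f : Euc d → ℝ} {x : Euc d}
    (hf : ContDiffAt ℝ 2 f x) : ∀ᶠ y in 𝓝 x, DifferentiableAt ℝ f y := by
  filter_upwards [hf.eventually (by simp)] with y hy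
  exact hy.differentiableAt (by norm_num)

theorem lapl_add {f g : Euc d → ℝ} {x : Euc d} (hf : ContDiffAt ℝ 2 f x)
    (hg : ContDiffAt ℝ 2 g x) : lapl d (fun y => f y + g y) x = lapl d f x + lapl d g x := by
  unfold lapl
  rw [← Finset.sum_add_distrib]
  refine Finset.sum_congr rfl fun i _ => ?_
  have h1 : (fun y => fderiv ℝ (fun y => f y + g y) y (coordVec i)) =ᶠ[𝓝 x]
      fun y => fderiv ℝ f y (coordVec i) + fderiv ℝ g y (coordVec i) := by
    filter_upwards [hf.eventually_differentiableAt, hg.eventually_differentiableAt] with y h1 h2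
    rw [fderiv_fun_add h1 h2]; rfl
  rw [h1.fderiv_eq, fderiv_fun_add (hf.differentiableAt_fderiv_apply _)
    (hg.differentiableAt_fderiv_apply _)]
  rfl

theorem lapl_const_mul {f : Euc d → ℝ} {x : Euc d} (c : ℝ) (hf : ContDiffAt ℝ 2 f x) :
    lapl d (fun y => c * f y) x = c * lapl d f x := by
  unfold lapl
  rw [Finset.mul_sum]
  refine Finset.sum_congr rfl fun i _ => ?_
  have h1 : (fun y => fderiv ℝ (fun y => c * f y) y (coordVec i)) =ᶠ[𝓝 x]
      fun y => c * fderiv ℝ f y (coordVec i) := by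
    filter_upwards [hf.eventually_differentiableAt] with y h1
    rw [fderiv_const_mul h1]; rfl
  rw [h1.fderiv_eq, fderiv_const_mul (hf.differentiableAt_fderiv_apply _)]
  rfl

theorem lapl_neg {f : Euc d → ℝ} {x : Euc d} (hf : ContDiffAt ℝ 2 f x) :
    lapl d (fun y => -f y) x = -lapl d f x := by
  simpa using lapl_const_mul (-1) hf

theorem lapl_sub {f g : Euc d → ℝ} {x : Euc d} (hf : ContDiffAt ℝ 2 f x)
    (hg : ContDiffAt ℝ 2 g x) : lapl d (fun y => f y - g y) x = lapl d f x - lapl d g x := by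
  simp only [sub_eq_add_neg]
  rw [lapl_add hf hg.neg, lapl_neg hg]

theorem lapl_const (c : ℝ) (x : Euc d) : lapl d (fun _ => c) x = 0 := by
  simp [lapl]

theorem hasDerivAt_comp_line {f : Euc d → ℝ} {x v : Euc d} {t : ℝ}
    (hf : DifferentiableAt ℝ f (x + t • v)) :
    HasDerivAt (fun s : ℝ => f (x + s • v)) (fderiv ℝ f (x + t • v) v) t := by
  have h : HasDerivAt (fun s : ℝ => x + s • v) v t := by
    simpa using ((hasDerivAt_id t).smul_const v).const_add x
  exact hf.hasFDerivAt.comp_hasDerivAt t h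

theorem tendsto_line (x v : Euc d) : Tendsto (fun s : ℝ => x + s • v) (𝓝 0) (𝓝 x) := by
  have : Continuous fun s : ℝ => x + s • v := by fun_prop
  simpa using this.tendsto 0

/-- The second derivative test. -/
theorem lapl_nonpos_of_isLocalMax {f : Euc d → ℝ} {x : Euc d} (hf : ContDiffAt ℝ 2 f x)
    (hmax : IsLocalMax f x) : lapl d f x ≤ 0 := by
  refine Finset.sum_nonpos fun i _ => ?_
  by_contra! hpos
  set v : Euc d := coordVec i
  set φ : ℝ → ℝ := fun s => f (x + s • v)
  have hd : deriv φ =ᶠ[𝓝 0] fun s => fderiv ℝ f (x + s • v) v := by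
    filter_upwards [(tendsto_line x v).eventually hf.eventually_differentiableAt] with s hs
    exact (hasDerivAt_comp_line hs).deriv
  have hdd : deriv (deriv φ) 0 = fderiv ℝ (fun y => fderiv ℝ f y v) x v := by
    rw [hd.deriv_eq]
    have h := hasDerivAt_comp_line (f := fun y => fderiv ℝ f y v) (x := x) (v := v) (t := 0)
      (by simpa using hf.differentiableAt_fderiv_apply v)
    simpa using h.deriv
  have hφmax : IsLocalMax φ 0 := by
    have h := (tendsto_line x v).eventually hmax
    filter_upwards [h] with s hs
    simpa [φ] using hs
  have hφmin : IsLocalMin φ 0 := by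
    apply isLocalMin_of_deriv_deriv_pos (by rw [hdd]; exact hpos) hφmax.deriv_eq_zero
    exact (hasDerivAt_comp_line (by simpa using hf.differentiableAt (by norm_num))).continuousAt
  have hconst : φ =ᶠ[𝓝 0] fun _ => φ 0 := by
    filter_upwards [hφmax, hφmin] with s h1 h2
    exact le_antisymm h1 h2
  have : deriv (deriv φ) 0 = 0 := by
    rw [(hconst.deriv).deriv_eq]
    simp
  rw [hdd] at this
  exact absurd this hpos.ne'

end Laplacian

section Polynomial

variable {d : ℕ}

/-- The algebraic Laplacian of a polynomial. -/
def polyLapl (d : ℕ) (p : MvPolynomial (Fin d) ℝ) : MvPolynomial (Fin d) ℝ :=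
  ∑ i, MvPolynomial.pderiv i (MvPolynomial.pderiv i p)

theorem hasFDerivAt_coord (j : Fin d) (x : Euc d) :
    HasFDerivAt (fun y : Euc d => y j) (EuclideanSpace.proj j : Euc d →L[ℝ] ℝ) x :=
  (EuclideanSpace.proj j : Euc d →L[ℝ] ℝ).hasFDerivAt

theorem contDiff_pev (p : MvPolynomial (Fin d) ℝ) {k : WithTop ℕ∞} :
    ContDiff ℝ k (pev p : Euc d → ℝ) := by
  unfold pev
  induction p using MvPolynomial.induction_on with
  | C a => simpa using contDiff_const
  | add p q hp hq => simpa using hp.add hq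
  | mul_X p i hp =>
    have : ContDiff ℝ k fun y : Euc d => y i := (EuclideanSpace.proj i : Euc d →L[ℝ] ℝ).contDiff
    simpa using hp.mul this

theorem fderiv_pev (p : MvPolynomial (Fin d) ℝ) (x : Euc d) (i : Fin d) :
    fderiv ℝ (pev p) x (coordVec i) = pev (MvPolynomial.pderiv i p) x := by
  induction p using MvPolynomial.induction_on with
  | C a =>
    have : (pev (MvPolynomial.C a) : Euc d → ℝ) = fun _ => a := by ext; simp [pev]
    simp [this, pev]
  | add p q hp hq =>
    have h : (pev (p + q) : Euc d → ℝ) = fun y => pev p y + pev q y := by ext; simp [pev]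
    have h1 := ((contDiff_pev p (k := 1)).differentiable (by norm_num)) x
    have h2 := ((contDiff_pev q (k := 1)).differentiable (by norm_num)) x
    rw [h, fderiv_fun_add h1 h2]
    simp [hp, hq, pev]
  | mul_X p j hp =>
    have h : (pev (p * MvPolynomial.X j) : Euc d → ℝ) = fun y => pev p y * y j := by
      ext; simp [pev]
    have h1 := ((contDiff_pev p (k := 1)).differentiable (by norm_num)) x
    rw [h, fderiv_fun_mul h1 (hasFDerivAt_coord j x).differentiableAt, (hasFDerivAt_coord j x).fderiv]
    simp only [add_apply, smul_apply, hp, smul_eq_mul]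
    by_cases hij : j = i
    · subst hij
      simp [pev, Derivation.leibniz]
    · simp [pev, Derivation.leibniz, MvPolynomial.pderiv_X, hij]

theorem lapl_pev (p : MvPolynomial (Fin d) ℝ) (x : Euc d) :
    lapl d (pev p) x = pev (polyLapl d p) x := by
  unfold lapl polyLapl
  simp only [fderiv_pev]
  have : ∀ i : Fin d, fderiv ℝ (pev (MvPolynomial.pderiv i p)) x (coordVec i) = _ :=
    fun i => fderiv_pev _ x i
  simp only [pev, map_sum] at this ⊢

theorem polyLapl_add (p q : MvPolynomial (Fin d) ℝ) :
    polyLapl d (p + q) = polyLapl d p + polyLapl d q := by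
  simp [polyLapl, Finset.sum_add_distrib]

theorem polyLapl_smul (c : ℝ) (p : MvPolynomial (Fin d) ℝ) :
    polyLapl d (c • p) = c • polyLapl d p := by
  simp [polyLapl, Finset.smul_sum]

theorem polyLapl_sub (p q : MvPolynomial (Fin d) ℝ) :
    polyLapl d (p - q) = polyLapl d p - polyLapl d q := by
  simp [polyLapl, Finset.sum_sub_distrib]

theorem pev_add (p q : MvPolynomial (Fin d) ℝ) (x : Euc d) : pev (p + q) x = pev p x + pev q x := by
  simp [pev]

theorem pev_sub (p q : MvPolynomial (Fin d) ℝ) (x : Euc d) : pev (p - q) x = pev p x - pev q x := by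
  simp [pev]

theorem pev_mul (p q : MvPolynomial (Fin d) ℝ) (x : Euc d) : pev (p * q) x = pev p x * pev q x := by
  simp [pev]

theorem pev_C (c : ℝ) (x : Euc d) : pev (MvPolynomial.C c) x = c := by
  simp [pev]

theorem pev_eq_zero {p : MvPolynomial (Fin d) ℝ} (h : ∀ x : Euc d, pev p x = 0) : p = 0 := by
  apply MvPolynomial.funext
  intro y
  simpa [pev] using h (WithLp.toLp 2 y)

/-- The polynomial `|x - z|²`. -/
def sqDistPoly (z : Euc d) : MvPolynomial (Fin d) ℝ :=
  ∑ i, (MvPolynomial.X i - MvPolynomial.C (z i)) ^ 2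

theorem pev_sqDistPoly (z x : Euc d) : pev (sqDistPoly z) x = ‖x - z‖ ^ 2 := by
  simp [pev, sqDistPoly, EuclideanSpace.norm_sq_eq]

theorem polyLapl_sqDistPoly (z : Euc d) : polyLapl d (sqDistPoly z) = MvPolynomial.C (2 * d : ℝ) := by
  have h : ∀ i : Fin d, MvPolynomial.pderiv i (sqDistPoly z) =
      2 * (MvPolynomial.X i - MvPolynomial.C (z i)) := by
    intro i
    simp [sqDistPoly, map_sum, Derivation.leibniz_pow, MvPolynomial.pderiv_X, Pi.single_apply]
  unfold polyLapl
  have h2 : ∀ i : Fin d, MvPolynomial.pderiv i (MvPolynomial.pderiv i (sqDistPoly z)) =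
      MvPolynomial.C 2 := by
    intro i
    rw [h, show (2 : MvPolynomial (Fin d) ℝ) = MvPolynomial.C 2 from rfl, MvPolynomial.pderiv_C_mul]
    simp
  simp [h2, mul_comm]

theorem contDiff_normSq_sub (z : Euc d) {k : WithTop ℕ∞} :
    ContDiff ℝ k fun x : Euc d => ‖x - z‖ ^ 2 := by
  have h := contDiff_pev (sqDistPoly z) (k := k)
  rwa [funext (pev_sqDistPoly z)] at h

theorem lapl_normSq_sub (z x : Euc d) : lapl d (fun y => ‖y - z‖ ^ 2) x = 2 * d := by
  rw [← funext (pev_sqDistPoly z), lapl_pev, polyLapl_sqDistPoly, pev_C]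

end Polynomial

section MaximumPrinciple

variable {d : ℕ}

/-- The maximum principle for functions that are touched from below at every point
by twice differentiable functions with nonnegative Laplacian. -/
theorem nonpos_of_touched_below [NeZero d] {U : Set (Euc d)} (hU : IsOpen U)
    (hb : Bornology.IsBounded U) {f : Euc d → ℝ} (hf : ContinuousOn f (closure U))
    (ht : ∀ z ∈ U, ∃ g : Euc d → ℝ, ContDiffAt ℝ 2 g z ∧ g z = f z ∧
      (∀ᶠ x in 𝓝 z, g x ≤ f x) ∧ 0 ≤ lapl d g z)
    (hfr : ∀ x ∈ frontier U, f x ≤ 0) : ∀ x ∈ U, f x ≤ 0 := by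
  intro x₁ hx₁
  by_contra! hpos
  obtain ⟨R, hR⟩ := hb.closure.subset_closedBall (0 : Euc d)
  have hnorm : ∀ x ∈ closure U, ‖x‖ ^ 2 ≤ R ^ 2 := fun x hx => by
    have := hR hx
    rw [mem_closedBall_zero_iff] at this
    gcongr
  set δ : ℝ := f x₁ / (2 * (R ^ 2 + 1))
  have hδ : 0 < δ := by positivity
  have hδR : δ * R ^ 2 < f x₁ := by
    have : δ * (2 * (R ^ 2 + 1)) = f x₁ := div_mul_cancel₀ _ (by positivity)
    nlinarith [sq_nonneg R]
  have hcont : ContinuousOn (fun x => f x + δ * ‖x - 0‖ ^ 2) (closure U) :=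
    hf.add (by fun_prop)
  obtain ⟨z, hzU, hz⟩ := (Metric.isCompact_of_isClosed_isBounded isClosed_closure hb.closure).exists_isMaxOn
    ⟨x₁, subset_closure hx₁⟩ hcont
  have hz1 : f x₁ ≤ f z + δ * ‖z - 0‖ ^ 2 := by
    have := hz (subset_closure hx₁)
    simp only [mem_ofPred_eq] at this
    nlinarith [mul_nonneg hδ.le (sq_nonneg ‖x₁ - 0‖)]
  have hzin : z ∈ U := by
    by_contra hzn
    have h1 := hfr z ⟨hzU, by rwa [hU.interior_eq]⟩
    have h2 := hnorm z hzU
    rw [sub_zero] at hz1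
    nlinarith [mul_le_mul_of_nonneg_left h2 hδ.le]
  obtain ⟨g, hg, hgz, hgle, hlap⟩ := ht z hzin
  have hq : ContDiffAt ℝ 2 (fun x : Euc d => ‖x - 0‖ ^ 2) z := (contDiff_normSq_sub 0).contDiffAt
  have hmax : IsLocalMax (fun x => g x + δ * ‖x - 0‖ ^ 2) z := by
    filter_upwards [hgle, hU.mem_nhds hzin] with x hx hxU
    have h3 : f x + δ * ‖x - 0‖ ^ 2 ≤ f z + δ * ‖z - 0‖ ^ 2 := hz (subset_closure hxU)
    simp only [hgz]
    linarith
  have hle := lapl_nonpos_of_isLocalMax (hg.add (contDiffAt_const.mul hq)) hmax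
  rw [lapl_add hg (contDiffAt_const.mul hq), lapl_const_mul _ hq, lapl_normSq_sub] at hle
  have hd : (0 : ℝ) < d := Nat.cast_pos.mpr (NeZero.pos d)
  nlinarith [mul_pos hδ hd]

theorem nonpos_of_lapl_nonneg [NeZero d] {U : Set (Euc d)} (hU : IsOpen U)
    (hb : Bornology.IsBounded U) {f : Euc d → ℝ} (hf : ContDiff ℝ 2 f)
    (hl : ∀ z ∈ U, 0 ≤ lapl d f z)
    (hfr : ∀ x ∈ frontier U, f x ≤ 0) : ∀ x ∈ U, f x ≤ 0 :=
  nonpos_of_touched_below hU hb hf.continuous.continuousOn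
    (fun z hz => ⟨f, hf.contDiffAt, rfl, Eventually.of_forall fun _ => le_rfl, hl z hz⟩) hfr

/-- Bounds on a sphere for harmonic polynomials persist inside. -/
theorem pev_le_of_le_sphere [NeZero d] {z : Euc d} {r : ℝ} {p : MvPolynomial (Fin d) ℝ}
    (hp : polyLapl d p = 0) {c : ℝ} (h : ∀ x ∈ sphere z r, pev p x ≤ c) :
    ∀ x ∈ ball z r, pev p x ≤ c := by
  intro x hx
  have := nonpos_of_lapl_nonneg (f := pev (p - MvPolynomial.C c)) isOpen_ball
    isBounded_ball (contDiff_pev _) (fun y _ => by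
      rw [lapl_pev, polyLapl_sub, hp]; simp [polyLapl, pev])
    (fun y hy => by
      have := h y (frontier_ball_subset_sphere hy)
      rw [pev_sub, pev_C]; linarith) x hx
  rw [pev_sub, pev_C] at this
  linarith

end MaximumPrinciple

section Dirichlet

variable {d : ℕ}

theorem totalDegree_pderiv_le (i : Fin d) (p : MvPolynomial (Fin d) ℝ) :
    (MvPolynomial.pderiv i p).totalDegree ≤ p.totalDegree - 1 := by
  conv_lhs => rw [p.as_sum, map_sum]
  refine MvPolynomial.totalDegree_finsetSum_le fun s hs => ?_
  rw [MvPolynomial.pderiv_monomial]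
  by_cases hsi : s i = 0
  · simp [hsi]
  · refine (MvPolynomial.totalDegree_monomial_le _ _).trans ?_
    have h1 := MvPolynomial.le_totalDegree hs
    have h2 : (s - Finsupp.single i 1) + Finsupp.single i 1 = s :=
      tsub_add_cancel_of_le (by simpa using Nat.one_le_iff_ne_zero.mpr hsi)
    have h3 : Finsupp.degree (s - Finsupp.single i 1) + 1 = Finsupp.degree s := by
      conv_rhs => rw [← h2]
      simp
    change Finsupp.degree s ≤ _ at h1
    change Finsupp.degree _ ≤ _
    omega

theorem totalDegree_polyLapl_le (p : MvPolynomial (Fin d) ℝ) :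
    (polyLapl d p).totalDegree ≤ p.totalDegree - 2 := by
  refine MvPolynomial.totalDegree_finsetSum_le fun i _ => ?_
  have h1 := totalDegree_pderiv_le i p
  have h2 := totalDegree_pderiv_le i (MvPolynomial.pderiv i p)
  omega

theorem eq_zero_of_pev_eq_zero_ball {z : Euc d} {r : ℝ} (hr : 0 < r)
    {p : MvPolynomial (Fin d) ℝ} (h : ∀ x ∈ ball z r, pev p x = 0) : p = 0 := by
  have ha : AnalyticOnNhd ℝ (pev p : Euc d → ℝ) univ :=
    fun x _ => ((contDiff_pev p (k := ⊤)).contDiffAt (x := x)).analyticAt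
  have h0 : (pev p : Euc d → ℝ) =ᶠ[𝓝 z] fun _ => 0 := by
    filter_upwards [ball_mem_nhds z hr] with x hx using h x hx
  have := ha.eq_of_eventuallyEq analyticOnNhd_const h0
  exact pev_eq_zero fun x => congrFun this x

/-- The polynomial `r² - |x - z|²`. -/
def ballPoly (z : Euc d) (r : ℝ) : MvPolynomial (Fin d) ℝ := MvPolynomial.C (r ^ 2) - sqDistPoly z

theorem pev_ballPoly (z : Euc d) (r : ℝ) (x : Euc d) :
    pev (ballPoly z r) x = r ^ 2 - ‖x - z‖ ^ 2 := by
  rw [ballPoly, pev_sub, pev_C, pev_sqDistPoly]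

theorem totalDegree_ballPoly_le (z : Euc d) (r : ℝ) : (ballPoly z r).totalDegree ≤ 2 := by
  refine (MvPolynomial.totalDegree_sub _ _).trans (max_le (by rw [MvPolynomial.totalDegree_C]; omega) ?_)
  refine MvPolynomial.totalDegree_finsetSum_le fun i _ => ?_
  refine (MvPolynomial.totalDegree_pow _ _).trans ?_
  have h : (MvPolynomial.X i - MvPolynomial.C (z i) : MvPolynomial (Fin d) ℝ).totalDegree ≤ 1 :=
    (MvPolynomial.totalDegree_sub _ _).trans (max_le (by simp) (by simp))
  omega

/-- The Dirichlet problem on a ball with polynomial data has a polynomial solution. -/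
theorem exists_harmonic_eq_on_sphere [NeZero d] (z : Euc d) {r : ℝ} (hr : 0 < r)
    (p : MvPolynomial (Fin d) ℝ) :
    ∃ q : MvPolynomial (Fin d) ℝ, polyLapl d q = 0 ∧ ∀ x ∈ sphere z r, pev q x = pev p x := by
  set m := p.totalDegree
  let V := MvPolynomial.restrictTotalDegree (Fin d) ℝ m
  have hmem : ∀ q ∈ V, polyLapl d (ballPoly z r * q) ∈ V := by
    intro q hq
    rw [MvPolynomial.mem_restrictTotalDegree] at hq ⊢
    have h1 := totalDegree_polyLapl_le (ballPoly z r * q)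
    have h2 := MvPolynomial.totalDegree_mul (ballPoly z r) q
    have h3 := totalDegree_ballPoly_le z r
    omega
  let T : V →ₗ[ℝ] V :=
    { toFun := fun q => ⟨polyLapl d (ballPoly z r * q), hmem q q.2⟩
      map_add' := fun q q' => by
        ext1; simp [mul_add, polyLapl_add]
      map_smul' := fun c q => by
        ext1; simp [polyLapl_smul] }
  have hvan : ∀ q : MvPolynomial (Fin d) ℝ, ∀ x ∈ sphere z r, pev (ballPoly z r * q) x = 0 := by
    intro q x hx
    rw [pev_mul, pev_ballPoly, ← dist_eq_norm, mem_sphere.mp hx]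
    simp
  have hinj : Function.Injective T := by
    rw [← LinearMap.ker_eq_bot, LinearMap.ker_eq_bot']
    rintro ⟨q, hq⟩ hTq
    have h0 : polyLapl d (ballPoly z r * q) = 0 := congrArg Subtype.val hTq
    have h0' : polyLapl d (ballPoly z r * (-q)) = 0 := by
      have := polyLapl_smul (-1) (ballPoly z r * q)
      rw [h0] at this
      simpa using this
    have hz : ∀ x ∈ ball z r, pev q x = 0 := by
      intro x hx
      have h1 := pev_le_of_le_sphere h0 (fun y hy => (hvan q y hy).le) x hx
      have h2 := pev_le_of_le_sphere h0' (fun y hy => (hvan (-q) y hy).le) x hx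
      have h3 : pev (-q) x = - pev q x := by simp [pev]
      have h4 : 0 < r ^ 2 - ‖x - z‖ ^ 2 := by
        rw [mem_ball, dist_eq_norm] at hx
        nlinarith [norm_nonneg (x - z)]
      rw [pev_mul, pev_ballPoly] at h1 h2
      rw [h3] at h2
      nlinarith
    ext1
    exact eq_zero_of_pev_eq_zero_ball hr hz
  have hV : Module.Finite ℝ V := inferInstance
  obtain ⟨⟨q, hq⟩, hTq⟩ := (LinearMap.injective_iff_surjective.mp hinj)
    ⟨polyLapl d p, by
      rw [MvPolynomial.mem_restrictTotalDegree]
      exact (totalDegree_polyLapl_le p).trans (Nat.sub_le _ _)⟩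
  have h0 : polyLapl d (ballPoly z r * q) = polyLapl d p := congrArg Subtype.val hTq
  refine ⟨p - ballPoly z r * q, by rw [polyLapl_sub, h0, sub_self], fun x hx => ?_⟩
  rw [pev_sub, hvan q x hx, sub_zero]

theorem exists_poly_near {K : Set (Euc d)} (hK : IsCompact K) {g : Euc d → ℝ}
    (hg : ContinuousOn g K) {δ : ℝ} (hδ : 0 < δ) :
    ∃ p : MvPolynomial (Fin d) ℝ, ∀ x ∈ K, |pev p x - g x| < δ := by
  have : CompactSpace K := isCompact_iff_compactSpace.mp hK
  let coord : Fin d → C(K, ℝ) := fun i => ⟨fun x => (x : Euc d) i, by fun_prop⟩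
  let A : Subalgebra ℝ C(K, ℝ) := (MvPolynomial.aeval coord).range
  have hev : ∀ (p : MvPolynomial (Fin d) ℝ) (x : K), MvPolynomial.aeval coord p x = pev p x := by
    intro p x
    unfold pev
    induction p using MvPolynomial.induction_on with
    | C a => simp
    | add p q hp hq => simp [hp, hq]
    | mul_X p i hp => simp [hp, coord]
  have hsep : A.SeparatesPoints := by
    intro x y hxy
    have : ∃ i, (x : Euc d) i ≠ (y : Euc d) i := by
      by_contra! hall
      exact hxy (Subtype.ext (PiLp.ext hall))
    obtain ⟨i, hi⟩ := this
    refine ⟨coord i, ⟨coord i, ⟨MvPolynomial.X i, by simp⟩, rfl⟩, hi⟩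
  obtain ⟨⟨g', p, rfl⟩, hg'⟩ :=
    ContinuousMap.exists_mem_subalgebra_near_continuous_of_separatesPoints A hsep
      (K.domRestrict g) hg.domRestrict δ hδ
  refine ⟨p, fun x hx => ?_⟩
  have := hg' ⟨x, hx⟩
  rw [← hev p ⟨x, hx⟩]
  exact this

/-- Continuous functions on a sphere are approximated by harmonic polynomials. -/
theorem exists_harmonic_near_on_sphere [NeZero d] (z : Euc d) {r : ℝ} (hr : 0 < r)
    {g : Euc d → ℝ} (hg : Continuous g) {δ : ℝ} (hδ : 0 < δ) :
    ∃ q : MvPolynomial (Fin d) ℝ, polyLapl d q = 0 ∧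
      ∀ x ∈ sphere z r, |pev q x - g x| < δ := by
  obtain ⟨p, hp⟩ := exists_poly_near (isCompact_sphere z r) hg.continuousOn hδ
  obtain ⟨q, hq, hqp⟩ := exists_harmonic_eq_on_sphere z hr p
  exact ⟨q, hq, fun x hx => by rw [hqp x hx]; exact hp x hx⟩

end Dirichlet

section ComparisonSuperharmonic

variable {d : ℕ}

/-- Superharmonicity in the comparison sense: subharmonic test functions lying below `w` on a
sphere lie below `w` in the ball. -/
def CompSuper (d : ℕ) (w : Euc d → ℝ) : Prop :=
  ∀ (z : Euc d) (r : ℝ), 0 < r → ∀ h : Euc d → ℝ, ContDiff ℝ 2 h →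
    (∀ x ∈ ball z r, 0 ≤ lapl d h x) → (∀ x ∈ sphere z r, h x ≤ w x) →
    ∀ x ∈ ball z r, h x ≤ w x

theorem compSuper_of_touched_above [NeZero d] {w : Euc d → ℝ} (hw : Continuous w)
    (ht : ∀ z, ∃ g : Euc d → ℝ, ContDiffAt ℝ 2 g z ∧ g z = w z ∧
      (∀ᶠ x in 𝓝 z, w x ≤ g x) ∧ lapl d g z ≤ 0) : CompSuper d w := by
  intro z r hr h hh hl hs x hx
  have := nonpos_of_touched_below (f := fun y => h y - w y) (isOpen_ball (x := z) (ε := r))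
    isBounded_ball (hh.continuous.sub hw).continuousOn (fun y hy => by
      obtain ⟨g, hg, hgy, hle, hlg⟩ := ht y
      refine ⟨fun y => h y - g y, hh.contDiffAt.sub hg, by simp only [hgy], ?_, ?_⟩
      · filter_upwards [hle] with a ha
        linarith
      · rw [lapl_sub hh.contDiffAt hg]
        linarith [hl y hy])
    (fun y hy => by linarith [hs y (frontier_ball_subset_sphere hy)]) x hx
  linarith

theorem CompSuper.add_const {w : Euc d → ℝ} (hw : CompSuper d w) (c : ℝ) :
    CompSuper d fun x => w x + c := by
  intro z r hr h hh hl hs x hx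
  have := hw z r hr (fun y => h y - c) (hh.sub contDiff_const) (fun y hy => by
      rw [lapl_sub hh.contDiffAt contDiffAt_const, lapl_const]
      linarith [hl y hy]) (fun y hy => by linarith [hs y hy]) x hx
  linarith

theorem lapl_comp_add_right (h : Euc d → ℝ) (a x : Euc d) :
    lapl d (fun y => h (y + a)) x = lapl d h (x + a) := by
  unfold lapl
  refine Finset.sum_congr rfl fun i _ => ?_
  have h1 : (fun y => fderiv ℝ (fun y => h (y + a)) y (coordVec i)) =
      fun y => (fun y' => fderiv ℝ h y' (coordVec i)) (y + a) := by
    ext y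
    rw [fderiv_comp_add_right]
  rw [h1]
  exact congrArg (fun L : Euc d →L[ℝ] ℝ => L (coordVec i))
    (fderiv_comp_add_right (𝕜 := ℝ) (f := fun y' => fderiv ℝ h y' (coordVec i)) a)

theorem CompSuper.translate {w : Euc d → ℝ} (hw : CompSuper d w) (a : Euc d) :
    CompSuper d fun x => w (x + a) := by
  intro z r hr h hh hl hs x hx
  have := hw (z + a) r hr (fun y => h (y + -a)) (hh.comp (contDiff_id.add contDiff_const))
    (fun y hy => by
      rw [lapl_comp_add_right]
      apply hl
      rw [mem_ball] at hy ⊢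
      rwa [← dist_add_right _ _ a, neg_add_cancel_right])
    (fun y hy => by
      have := hs (y + -a) (by
        rw [mem_sphere] at hy ⊢
        rwa [← dist_add_right _ _ a, neg_add_cancel_right])
      simpa using this) (x + a) (by simpa using hx)
  simpa using this

open Classical in
/-- Replacing `w` by `min w g` on an open set `Q`, where `g ≥ w` on the frontier of `Q`. -/
def glueMin (Q : Set (Euc d)) (w g : Euc d → ℝ) : Euc d → ℝ :=
  Q.piecewise (fun x => min (w x) (g x)) w

theorem glueMin_of_mem {Q : Set (Euc d)} (w g : Euc d → ℝ) {x : Euc d} (hx : x ∈ Q) :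
    glueMin Q w g x = min (w x) (g x) := by simp [glueMin, hx]

theorem glueMin_of_notMem {Q : Set (Euc d)} (w g : Euc d → ℝ) {x : Euc d} (hx : x ∉ Q) :
    glueMin Q w g x = w x := by simp [glueMin, hx]

theorem glueMin_le (Q : Set (Euc d)) (w g : Euc d → ℝ) (x : Euc d) : glueMin Q w g x ≤ w x := by
  by_cases hx : x ∈ Q
  · rw [glueMin_of_mem w g hx]; exact min_le_left _ _
  · rw [glueMin_of_notMem w g hx]

theorem continuous_glueMin {Q : Set (Euc d)} {w g : Euc d → ℝ} (hw : Continuous w)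
    (hg : Continuous g) (hfr : ∀ x ∈ frontier Q, w x ≤ g x) : Continuous (glueMin Q w g) := by
  classical
  unfold glueMin
  exact Continuous.piecewise (fun x hx => min_eq_left (hfr x hx)) (hw.min hg) hw

theorem compSuper_glueMin [NeZero d] {Q : Set (Euc d)} (hQ : IsOpen Q) {w g : Euc d → ℝ}
    (hw : CompSuper d w) (hg : ContDiff ℝ 2 g) (hl : ∀ x ∈ Q, lapl d g x ≤ 0)
    (hfr : ∀ x ∈ frontier Q, w x ≤ g x) : CompSuper d (glueMin Q w g) := by
  intro z r hr h hh hlh hs x hx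
  have hhw : ∀ y ∈ ball z r, h y ≤ w y :=
    hw z r hr h hh hlh fun y hy => (hs y hy).trans (glueMin_le _ _ _ _)
  by_cases hxQ : x ∈ Q
  · rw [glueMin_of_mem w g hxQ]
    refine le_min (hhw x hx) ?_
    have := nonpos_of_lapl_nonneg (f := fun y => h y - g y) (U := ball z r ∩ Q)
      (isOpen_ball.inter hQ) (isBounded_ball.subset inter_subset_left) (hh.sub hg)
      (fun y hy => by
        rw [lapl_sub hh.contDiffAt hg.contDiffAt]
        linarith [hlh y hy.1, hl y hy.2])
      (fun y hy => ?_) x ⟨hx, hxQ⟩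
    · linarith
    · have hyB : y ∈ closedBall z r :=
        closure_ball_subset_closedBall (closure_mono inter_subset_left hy.1)
      have hyQ : y ∈ closure Q := closure_mono inter_subset_right hy.1
      have hyn : ¬ (y ∈ ball z r ∧ y ∈ Q) := by
        have := hy.2
        rwa [(isOpen_ball.inter hQ).interior_eq] at this
      by_cases hyQ' : y ∈ Q
      · have hyS : y ∈ sphere z r := by
          have : y ∉ ball z r := fun hb => hyn ⟨hb, hyQ'⟩
          rw [mem_ball, not_lt] at this
          exact le_antisymm hyB this
        have := hs y hyS
        rw [glueMin_of_mem w g hyQ'] at this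
        linarith [min_le_right (w y) (g y)]
      · have h1 := hfr y ⟨hyQ, by rwa [hQ.interior_eq]⟩
        have h2 : h y ≤ w y := by
          by_cases hyb : y ∈ ball z r
          · exact hhw y hyb
          · rw [mem_ball, not_lt] at hyb
            exact (hs y (le_antisymm hyB hyb)).trans (glueMin_le _ _ _ _)
        linarith
  · rw [glueMin_of_notMem w g hxQ]
    exact hhw x hx

end ComparisonSuperharmonic

section MeanValue

variable {d : ℕ}

/-- The unnormalised mean of `w` over the sphere of radius `r` around `z`. -/
def sphereInt (w : Euc d → ℝ) (z : Euc d) (r : ℝ) : ℝ :=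
  ∫ ζ : sphere (0 : Euc d) 1, w (z + r • (ζ : Euc d)) ∂(volume : Measure (Euc d)).toSphere

theorem integral_norm_mul_eq [NeZero d] {w : Euc d → ℝ} {z : Euc d} {φ : ℝ → ℝ}
    (hi : Integrable fun y : Euc d => φ ‖y‖ * w (z + y)) :
    ∫ y : Euc d, φ ‖y‖ * w (z + y) =
      ∫ r in Ioi (0 : ℝ), r ^ (d - 1) * (φ r * sphereInt w z r) := by
  have hdim : Module.finrank ℝ (Euc d) = d := by simp
  have : Nontrivial (Euc d) := Module.nontrivial_of_finrank_pos (R := ℝ) (by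
    rw [hdim]; exact Nat.pos_of_ne_zero (NeZero.ne d))
  set μ : Measure (Euc d) := volume with hμ
  let G : sphere (0 : Euc d) 1 × Ioi (0 : ℝ) → ℝ :=
    fun x => φ x.2.1 * w (z + x.2.1 • (x.1 : Euc d))
  have hmp := μ.measurePreserving_homeomorphUnitSphereProd
  have hG : ∀ x : ({(0 : Euc d)}ᶜ : Set (Euc d)),
      G (homeomorphUnitSphereProd (Euc d) x) = φ ‖x.1‖ * w (z + x.1) := by
    intro x
    have hx : ‖x.1‖ ≠ 0 := by
      exact norm_ne_zero_iff.2 x.2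
    simp [G, smul_smul, hx]
  have h1 : ∫ y, φ ‖y‖ * w (z + y) ∂μ =
      ∫ x : ({(0)}ᶜ : Set (Euc d)), φ ‖x.1‖ * w (z + x.1) ∂(μ.comap (↑)) := by
    rw [integral_subtype_comap (measurableSet_singleton _).compl
      fun y : Euc d => φ ‖y‖ * w (z + y), restrict_compl_singleton]
  have h2 := hmp.integral_comp (Homeomorph.measurableEmbedding _) G
  have hiG : Integrable G (μ.toSphere.prod
      (Measure.volumeIoiPow (Module.finrank ℝ (Euc d) - 1))) := by
    rw [← hmp.integrable_comp_emb (Homeomorph.measurableEmbedding _)]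
    have : (G ∘ homeomorphUnitSphereProd (Euc d)) =
        (fun y : Euc d => φ ‖y‖ * w (z + y)) ∘ ((↑) : ({(0 : Euc d)}ᶜ : Set (Euc d)) → Euc d) := by
      funext x; exact hG x
    rw [this, ← (MeasurableEmbedding.subtype_coe
      (measurableSet_singleton (0 : Euc d)).compl).integrableOn_range_iff_comap]
    exact hi.integrableOn
  rw [h1]
  simp only [← hG]
  rw [h2, integral_prod_symm _ hiG]
  have h3 : ∀ r : Ioi (0 : ℝ), ∫ ζ, G (ζ, r) ∂μ.toSphere = φ r.1 * sphereInt w z r.1 := by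
    intro r
    simp only [G, sphereInt]
    rw [integral_const_mul]
  simp only [h3]
  rw [hdim]
  simp only [Measure.volumeIoiPow, ENNReal.ofReal]
  rw [integral_withDensity_eq_integral_smul,
    integral_subtype_comap measurableSet_Ioi
      fun a => Real.toNNReal (a ^ (d - 1)) • (φ a * sphereInt w z a),
    setIntegral_congr_fun measurableSet_Ioi fun x hx => ?_]
  · rw [NNReal.smul_def, Real.coe_toNNReal _ (pow_nonneg hx.out.le _), smul_eq_mul]
  · exact (measurable_subtype_coe.pow_const _).real_toNNReal

theorem hasDerivAt_max_zero_sq (s : ℝ) : HasDerivAt (fun s : ℝ => (max s 0) ^ 2) (2 * max s 0) s := by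
  rcases lt_trichotomy s 0 with h | h | h
  · have : (fun s : ℝ => (max s 0) ^ 2) =ᶠ[𝓝 s] fun _ => 0 := by
      filter_upwards [Iio_mem_nhds h] with x hx
      simp [max_eq_right (le_of_lt (mem_Iio.1 hx))]
    rw [max_eq_right h.le, mul_zero]
    exact (hasDerivAt_const s (0 : ℝ)).congr_of_eventuallyEq this
  · subst h
    rw [max_self, mul_zero, hasDerivAt_iff_isLittleO]
    simp only [max_self, ne_eq, OfNat.ofNat_ne_zero, not_false_eq_true, zero_pow, sub_zero,
      smul_zero]
    refine Asymptotics.IsBigO.trans_isLittleO (g := fun x : ℝ => x ^ 2) ?_ ?_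
    · refine Asymptotics.IsBigO.of_bound 1 (Eventually.of_forall fun x => ?_)
      rw [one_mul, norm_pow, norm_pow]
      gcongr
      rw [Real.norm_eq_abs, Real.norm_eq_abs, abs_of_nonneg (le_max_right x 0)]
      exact max_le (le_abs_self x) (abs_nonneg x)
    · simpa using Asymptotics.isLittleO_pow_id (𝕜 := ℝ) (n := 2) (by norm_num)
  · have : (fun s : ℝ => (max s 0) ^ 2) =ᶠ[𝓝 s] fun s => s ^ 2 := by
      filter_upwards [Ioi_mem_nhds h] with x hx
      simp [max_eq_left (le_of_lt (mem_Ioi.1 hx))]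
    rw [max_eq_left h.le]
    simpa using (hasDerivAt_pow 2 s).congr_of_eventuallyEq this

/-- The bump `max (1 - r^2) 0`. -/
def capFun (r : ℝ) : ℝ := max (1 - r ^ 2) 0

theorem continuous_capFun : Continuous capFun := by unfold capFun; fun_prop

theorem capFun_eq_zero {r : ℝ} (hr : 1 ≤ r) : capFun r = 0 := by
  unfold capFun; exact max_eq_right (by nlinarith)

theorem hasCompactSupport_capFun : HasCompactSupport fun y : Euc d => capFun ‖y‖ := by
  refine HasCompactSupport.of_support_subset_isCompact (isCompact_closedBall (0 : Euc d) 1) ?_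
  intro y hy
  by_contra h
  rw [mem_closedBall_zero_iff, not_le] at h
  exact hy (capFun_eq_zero h.le)

theorem integrable_capFun_mul {w : Euc d → ℝ} (hw : Continuous w) :
    Integrable fun y : Euc d => capFun ‖y‖ * w y :=
  ((continuous_capFun.comp continuous_norm).mul hw).integrable_of_hasCompactSupport
    (hasCompactSupport_capFun.mul_right)

theorem integrable_capFun_sq_mul {w : Euc d → ℝ} (hw : Continuous w) :
    Integrable fun y : Euc d => capFun ‖y‖ ^ 2 * w y := by
  have := integrable_capFun_mul (d := d) (((continuous_capFun.comp continuous_norm).mul hw))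
  refine this.congr (Eventually.of_forall fun y => ?_)
  change capFun ‖y‖ * (capFun ‖y‖ * w y) = _
  ring

theorem fderiv_capFun_sq (y : Euc d) (i : Fin d) :
    DifferentiableAt ℝ (fun y : Euc d => capFun ‖y‖ ^ 2) y ∧
    fderiv ℝ (fun y : Euc d => capFun ‖y‖ ^ 2) y (coordVec i) = -4 * (capFun ‖y‖ * y i) := by
  have h1 : HasFDerivAt (fun y : Euc d => 1 - ‖y‖ ^ 2) (-(2 • (innerSL ℝ y))) y := by
    exact ((hasStrictFDerivAt_norm_sq y).hasFDerivAt).const_sub 1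
  have h2 := (hasDerivAt_max_zero_sq (1 - ‖y‖ ^ 2)).comp_hasFDerivAt y h1
  have h3 : HasFDerivAt (fun y : Euc d => capFun ‖y‖ ^ 2) _ y := h2
  refine ⟨h3.differentiableAt, ?_⟩
  rw [h3.fderiv]
  simp [capFun, EuclideanSpace.inner_single_right]
  ring

theorem fderiv_pev_comp_affine (q : MvPolynomial (Fin d) ℝ) (z : Euc d) (t : ℝ) (y : Euc d)
    (i : Fin d) :
    DifferentiableAt ℝ (fun y : Euc d => pev q (z + t • y)) y ∧
    fderiv ℝ (fun y : Euc d => pev q (z + t • y)) y (coordVec i) =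
      t * pev (MvPolynomial.pderiv i q) (z + t • y) := by
  have h1 : HasFDerivAt (fun y : Euc d => z + t • y) (t • ContinuousLinearMap.id ℝ (Euc d)) y :=
    ((hasFDerivAt_id y).const_smul t).const_add z
  have h2 : HasFDerivAt (pev q) (fderiv ℝ (pev q) (z + t • y)) (z + t • y) :=
    ((contDiff_pev q (k := 1)).differentiable (by norm_num) _).hasFDerivAt
  have h3 := h2.comp y h1
  have h4 : HasFDerivAt (fun y : Euc d => pev q (z + t • y)) _ y := h3
  refine ⟨h4.differentiableAt, ?_⟩
  rw [h4.fderiv, ← fderiv_pev]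
  simp

theorem continuous_pev (q : MvPolynomial (Fin d) ℝ) : Continuous (pev q : Euc d → ℝ) :=
  (contDiff_pev q (k := 0)).continuous

theorem integral_capFun_coord (q : MvPolynomial (Fin d) ℝ) (z : Euc d) (t : ℝ) (i : Fin d) :
    ∫ y : Euc d, capFun ‖y‖ * (pev (MvPolynomial.pderiv i q) (z + t • y) * y i) =
      t / 4 * ∫ y : Euc d, capFun ‖y‖ ^ 2 *
        pev (MvPolynomial.pderiv i (MvPolynomial.pderiv i q)) (z + t • y) := by
  have hc : ∀ q : MvPolynomial (Fin d) ℝ, Continuous fun y : Euc d => pev q (z + t • y) :=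
    fun q => (continuous_pev q).comp (by fun_prop)
  set r := MvPolynomial.pderiv i q with hr
  have key := integral_mul_fderiv_eq_neg_fderiv_mul_of_integrable (μ := (volume : Measure (Euc d)))
    (f := fun y : Euc d => pev r (z + t • y)) (g := fun y : Euc d => capFun ‖y‖ ^ 2)
    (v := coordVec i) ?_ ?_ ?_ (fun y _ => (fderiv_pev_comp_affine r z t y i).1)
    (fun y _ => (fderiv_capFun_sq y i).1)
  · simp only [(fderiv_pev_comp_affine r z t _ i).2, (fderiv_capFun_sq _ i).2] at key
    have e1 : ∀ y : Euc d, pev r (z + t • y) * (-4 * (capFun ‖y‖ * y i)) =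
        -4 * (capFun ‖y‖ * (pev r (z + t • y) * y i)) := fun y => by ring
    have e2 : ∀ y : Euc d, t * pev (MvPolynomial.pderiv i r) (z + t • y) * capFun ‖y‖ ^ 2 =
        t * (capFun ‖y‖ ^ 2 * pev (MvPolynomial.pderiv i r) (z + t • y)) := fun y => by ring
    simp only [e1, e2] at key
    rw [integral_const_mul, integral_const_mul] at key
    linarith
  · simp only [(fderiv_pev_comp_affine r z t _ i).2]
    exact (integrable_capFun_sq_mul (continuous_const.mul (hc (MvPolynomial.pderiv i r)))).congr
      (Eventually.of_forall fun y => mul_comm _ _)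
  · simp only [(fderiv_capFun_sq _ i).2]
    refine (integrable_capFun_mul (w := fun y : Euc d => -4 * (pev r (z + t • y) * y i)) ?_).congr
      (Eventually.of_forall fun y => ?_)
    · have := hc r
      fun_prop
    · ring
  · exact (integrable_capFun_sq_mul (hc r)).congr
      (Eventually.of_forall fun y => mul_comm _ _)

theorem hasDerivAt_integral_capFun (q : MvPolynomial (Fin d) ℝ) (z : Euc d) (t : ℝ) :
    HasDerivAt (fun t : ℝ => ∫ y : Euc d, capFun ‖y‖ * pev q (z + t • y))
      (t / 4 * ∫ y : Euc d, capFun ‖y‖ ^ 2 * pev (polyLapl d q) (z + t • y)) t := by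
  obtain ⟨F', hF'⟩ : ∃ F' : ℝ → Euc d → ℝ, F' = fun t y =>
    capFun ‖y‖ * ∑ i, pev (MvPolynomial.pderiv i q) (z + t • y) * y i := ⟨_, rfl⟩
  have hc : ∀ q : MvPolynomial (Fin d) ℝ, Continuous fun x : ℝ × Euc d => pev q (z + x.1 • x.2) :=
    fun q => (continuous_pev q).comp (by fun_prop)
  have hct : ∀ (q : MvPolynomial (Fin d) ℝ) (t : ℝ), Continuous fun y : Euc d => pev q (z + t • y) :=
    fun q t => (continuous_pev q).comp (by fun_prop)
  have hF'c : Continuous (Function.uncurry F') := by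
    simp only [hF', Function.uncurry_def]
    refine (continuous_capFun.comp (by fun_prop)).mul (continuous_finsetSum _ fun i _ => ?_)
    exact (hc _).mul (by fun_prop)
  have hF'ct : ∀ t, Continuous (F' t) := fun t => hF'c.comp (continuous_const.prodMk continuous_id)
  obtain ⟨C, hC⟩ := ((isCompact_closedBall t 1).prod (isCompact_closedBall (0 : Euc d) 1)).exists_bound_of_continuousOn
    hF'c.continuousOn
  have hmain := hasDerivAt_integral_of_dominated_loc_of_deriv_le (𝕜 := ℝ)
    (μ := (volume : Measure (Euc d))) (s := closedBall t 1) (x₀ := t)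
    (F := fun t y => capFun ‖y‖ * pev q (z + t • y)) (F' := F')
    (bound := (closedBall (0 : Euc d) 1).indicator fun _ => C)
    (closedBall_mem_nhds t one_pos)
    (Eventually.of_forall fun s => (((continuous_capFun.comp continuous_norm).mul (hct q s)).aestronglyMeasurable))
    (integrable_capFun_mul (hct q t)) (hF'ct t).aestronglyMeasurable
    (Eventually.of_forall fun y s hs => ?_) ?_
    (Eventually.of_forall fun y s hs => ?_)
  · have e : ∫ y, F' t y = t / 4 * ∫ y : Euc d, capFun ‖y‖ ^ 2 * pev (polyLapl d q) (z + t • y) := by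
      simp only [hF', Finset.mul_sum]
      rw [integral_finsetSum]
      · simp only [integral_capFun_coord]
        rw [← Finset.mul_sum, ← integral_finsetSum]
        · congr 2
          funext y
          rw [← Finset.mul_sum]
          congr 1
          simp [polyLapl, pev]
        · intro i _
          exact integrable_capFun_sq_mul (hct _ t)
      · intro i _
        exact integrable_capFun_mul ((hct _ t).mul (by fun_prop))
    rw [← e]
    exact hmain.2
  · by_cases hy : y ∈ closedBall (0 : Euc d) 1
    · rw [indicator_of_mem hy]
      exact hC (s, y) ⟨hs, hy⟩
    · rw [indicator_of_notMem hy]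
      rw [mem_closedBall_zero_iff, not_le] at hy
      simp [hF', capFun_eq_zero hy.le]
  · exact (integrable_indicator_iff measurableSet_closedBall).2
      (integrableOn_const (isCompact_closedBall (0 : Euc d) 1).measure_lt_top.ne)
  · have h2 : HasFDerivAt (pev q) (fderiv ℝ (pev q) (z + s • y)) (z + s • y) :=
      ((contDiff_pev q (k := 1)).differentiable (by norm_num) _).hasFDerivAt
    have h1 : HasDerivAt (fun s : ℝ => z + s • y) y s := by
      simpa using ((hasDerivAt_id s).smul_const y).const_add z
    have h3 := (h2.comp_hasDerivAt s h1).const_mul (capFun ‖y‖)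
    have e : fderiv ℝ (pev q) (z + s • y) y =
        ∑ i, pev (MvPolynomial.pderiv i q) (z + s • y) * y i := by
      have hy : y = ∑ i, y i • (coordVec i : Euc d) := by
        ext j; simp [Finset.sum_apply, Pi.single_apply]
      conv_lhs => rw [show fderiv ℝ (pev q) (z + s • y) y =
        fderiv ℝ (pev q) (z + s • y) (∑ i, y i • (coordVec i : Euc d)) from congrArg _ hy]
      rw [map_sum]
      refine Finset.sum_congr rfl fun i _ => ?_
      rw [map_smul, fderiv_pev, smul_eq_mul, mul_comm]
    simp only [hF']
    rw [← e]
    exact h3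

theorem integral_capFun_harmonic {q : MvPolynomial (Fin d) ℝ} (hq : polyLapl d q = 0) (z : Euc d)
    (t : ℝ) : ∫ y : Euc d, capFun ‖y‖ * pev q (z + t • y) = ∫ y : Euc d, capFun ‖y‖ * pev q z := by
  have h : ∀ t : ℝ, HasDerivAt (fun t : ℝ => ∫ y : Euc d, capFun ‖y‖ * pev q (z + t • y)) 0 t := by
    intro t
    have := hasDerivAt_integral_capFun q z t
    rw [hq] at this
    simpa [pev] using this
  have := is_const_of_deriv_eq_zero (fun t => (h t).differentiableAt) (fun t => (h t).deriv) t 0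
  simpa using this

end MeanValue

section SphereMean

variable {d : ℕ}

theorem continuous_sphereInt {w : Euc d → ℝ} (hw : Continuous w) (z : Euc d) :
    Continuous (sphereInt w z) := by
  have h := continuous_parametric_integral_of_continuous
    (μ := (volume : Measure (Euc d)).toSphere)
    (f := fun (r : ℝ) (ζ : sphere (0 : Euc d) 1) => w (z + r • (ζ : Euc d)))
    (s := univ) (by fun_prop) isCompact_univ
  simp only [setIntegral_univ] at h
  exact h

theorem integrable_sphere {w : Euc d → ℝ} (hw : Continuous w) (z : Euc d) (r : ℝ) :
    Integrable (fun ζ : sphere (0 : Euc d) 1 => w (z + r • (ζ : Euc d)))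
      (volume : Measure (Euc d)).toSphere := by
  have : Continuous fun ζ : sphere (0 : Euc d) 1 => w (z + r • (ζ : Euc d)) := by fun_prop
  exact this.integrable_of_hasCompactSupport (HasCompactSupport.of_compactSpace _)

/-- Area of the unit sphere. -/
def sphereArea (d : ℕ) : ℝ := (volume : Measure (Euc d)).toSphere.real univ

theorem sphereInt_const (c : ℝ) (z : Euc d) (r : ℝ) :
    sphereInt (fun _ => c) z r = sphereArea d * c := by
  simp [sphereInt, sphereArea]

theorem eq_zero_of_integral_sq_sub {a : ℝ → ℝ} (ha : Continuous a)
    (h : ∀ t > 0, ∫ s in (0 : ℝ)..t, (t ^ 2 - s ^ 2) * a s = 0) {t : ℝ} (ht : 0 < t) : a t = 0 := by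
  have hi : ∀ (b : ℝ → ℝ), Continuous b → ∀ t, HasDerivAt (fun u => ∫ s in (0 : ℝ)..u, b s) (b t) t :=
    fun b hb t => intervalIntegral.integral_hasDerivAt_right (hb.intervalIntegrable _ _)
      (hb.stronglyMeasurableAtFilter _ _) hb.continuousAt
  have hF : ∀ t > 0, (fun t : ℝ => t ^ 2 * (∫ s in (0 : ℝ)..t, a s) - ∫ s in (0 : ℝ)..t, s ^ 2 * a s) t = 0 := by
    intro t ht
    have h1 := h t ht
    simp only [sub_mul] at h1
    have e1 : Continuous fun s => t ^ 2 * a s := by fun_prop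
    have e2 : Continuous fun s => s ^ 2 * a s := by fun_prop
    rw [intervalIntegral.integral_sub (e1.intervalIntegrable _ _) (e2.intervalIntegrable _ _),
      intervalIntegral.integral_const_mul] at h1
    exact h1
  have hz : ∀ (F : ℝ → ℝ) (F' t : ℝ), 0 < t → (∀ t > 0, F t = 0) → HasDerivAt F F' t → F' = 0 := by
    intro F F' t ht h0 hF
    have : F =ᶠ[𝓝 t] fun _ => 0 := by
      filter_upwards [Ioi_mem_nhds ht] with x hx using h0 x hx
    exact (hF.congr_of_eventuallyEq this.symm).unique (hasDerivAt_const t (0 : ℝ))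
  have hA : ∀ t > 0, (∫ s in (0 : ℝ)..t, a s) = 0 := by
    intro t ht
    have hd := ((hasDerivAt_pow 2 t).mul (hi a ha t)).sub
      (hi (fun s => s ^ 2 * a s) (by fun_prop) t)
    have := hz _ _ t ht hF hd
    simp only [Nat.cast_ofNat, Nat.add_one_sub_one, pow_one] at this
    have h2 : 2 * t * (∫ s in (0 : ℝ)..t, a s) = 0 := by linarith
    rcases mul_eq_zero.1 h2 with h3 | h3
    · exact absurd h3 (by positivity)
    · exact h3
  exact hz _ _ t ht hA (hi a ha t)

theorem setIntegral_Ioi_eq_interval {b : ℝ → ℝ} {R : ℝ} (hR : 0 ≤ R) (hb : ∀ r, R < r → b r = 0) :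
    ∫ r in Ioi (0 : ℝ), b r = ∫ r in (0 : ℝ)..R, b r := by
  rw [intervalIntegral.integral_of_le hR]
  refine (setIntegral_eq_of_subset_of_forall_sdiff_eq_zero measurableSet_Ioi Ioc_subset_Ioi_self ?_)
  intro x hx
  apply hb
  by_contra h
  exact hx.2 ⟨hx.1, not_lt.1 h⟩

/-- Spherical mean value property of harmonic polynomials. -/
theorem sphereInt_harmonic [NeZero d] {q : MvPolynomial (Fin d) ℝ} (hq : polyLapl d q = 0) (z : Euc d)
    {r : ℝ} (hr : 0 < r) : sphereInt (pev q) z r = sphereArea d * pev q z := by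
  have hk : Continuous fun r => sphereInt (pev q) z r - sphereArea d * pev q z :=
    (continuous_sphereInt (continuous_pev q) z).sub continuous_const
  have key : r ^ (d - 1) * (sphereInt (pev q) z r - sphereArea d * pev q z) = 0 := by
    refine eq_zero_of_integral_sq_sub
      (a := fun r => r ^ (d - 1) * (sphereInt (pev q) z r - sphereArea d * pev q z))
      (by fun_prop) ?_ hr
    intro t ht
    have hInt : ∀ u : ℝ, sphereInt (fun y => pev q (z + t • y)) 0 u = sphereInt (pev q) z (t * u) := by
      intro u
      simp only [sphereInt, zero_add, smul_smul]
    have hc : Continuous fun y : Euc d => pev q (z + t • y) :=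
      (continuous_pev q).comp (by fun_prop)
    have h1 := integral_norm_mul_eq (d := d) (w := fun y => pev q (z + t • y)) (z := 0) (φ := capFun)
      (by simpa using integrable_capFun_mul hc)
    have h2 := integral_norm_mul_eq (d := d) (w := fun _ => pev q z) (z := 0) (φ := capFun)
      (by simpa using integrable_capFun_mul (d := d) (w := fun _ => pev q z) continuous_const)
    simp only [zero_add] at h1 h2
    rw [integral_capFun_harmonic hq z t, h2] at h1
    simp only [hInt, sphereInt_const] at h1
    rw [setIntegral_Ioi_eq_interval zero_le_one (fun r hr => by rw [capFun_eq_zero hr.le]; ring),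
      setIntegral_Ioi_eq_interval zero_le_one (fun r hr => by rw [capFun_eq_zero hr.le]; ring)] at h1
    have hcs := continuous_sphereInt (continuous_pev q) z
    have hcap := continuous_capFun
    have h3 : ∫ u in (0 : ℝ)..1, u ^ (d - 1) *
        (capFun u * (sphereInt (pev q) z (t * u) - sphereArea d * pev q z)) = 0 := by
      simp only [mul_sub]
      have e1 : Continuous fun u => u ^ (d - 1) * (capFun u * sphereInt (pev q) z (t * u)) := by
        fun_prop
      have e2 : Continuous fun u => u ^ (d - 1) * (capFun u * (sphereArea d * pev q z)) := by
        fun_prop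
      rw [intervalIntegral.integral_sub (e1.intervalIntegrable _ _) (e2.intervalIntegrable _ _), h1,
        sub_self]
    have h4 := intervalIntegral.integral_comp_mul_left (a := 0) (b := 1) (fun s => (t ^ 2 - s ^ 2) *
      (s ^ (d - 1) * (sphereInt (pev q) z s - sphereArea d * pev q z))) ht.ne'
    have h5 : ∫ u in (0 : ℝ)..1, (t ^ 2 - (t * u) ^ 2) *
      ((t * u) ^ (d - 1) * (sphereInt (pev q) z (t * u) - sphereArea d * pev q z)) = 0 := by
      have h6 := congrArg (fun x => t ^ 2 * t ^ (d - 1) * x) h3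
      simp only [mul_zero] at h6
      rw [← intervalIntegral.integral_const_mul] at h6
      refine (intervalIntegral.integral_congr fun u hu => ?_).trans h6
      rw [uIcc_of_le zero_le_one] at hu
      simp only [capFun]
      rw [max_eq_left (by nlinarith [hu.1, hu.2]), mul_pow t u (d - 1)]
      ring
    rw [h5] at h4
    simp only [mul_zero, mul_one, smul_eq_mul] at h4
    rcases mul_eq_zero.1 h4.symm with h6 | h6
    · exact absurd h6 (by positivity)
    · exact h6
  rcases mul_eq_zero.1 key with h | h
  · exact absurd h (by positivity)
  · linarith

theorem sphereInt_mono {w g : Euc d → ℝ} (hw : Continuous w) (hg : Continuous g) {z : Euc d} {r : ℝ}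
    (hr : 0 ≤ r) (h : ∀ x ∈ sphere z r, w x ≤ g x) : sphereInt w z r ≤ sphereInt g z r := by
  refine integral_mono (integrable_sphere hw z r) (integrable_sphere hg z r) fun ζ => h _ ?_
  have : ‖(ζ : Euc d)‖ = 1 := by simp
  simp [norm_smul, this, abs_of_nonneg hr]

theorem CompSuper.sphereInt_le [NeZero d] {w : Euc d → ℝ} (hw : CompSuper d w) (hc : Continuous w)
    (z : Euc d) {r : ℝ} (hr : 0 < r) : sphereInt w z r ≤ sphereArea d * w z := by
  have hA : 0 ≤ sphereArea d := measureReal_nonneg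
  refine le_of_forall_pos_le_add fun e he => ?_
  set δ := e / (2 * sphereArea d + 1) with hδ
  have hδ0 : 0 < δ := by positivity
  obtain ⟨q, hq, hqw⟩ := exists_harmonic_near_on_sphere z hr hc hδ0
  have h1 : sphereInt w z r ≤ sphereInt (fun x => pev q x + δ) z r := by
    refine sphereInt_mono hc ((continuous_pev q).add continuous_const) hr.le fun x hx => ?_
    have := (abs_lt.1 (hqw x hx)).1
    change w x ≤ pev q x + δ
    linarith
  have h2 : sphereInt (fun x => pev q x + δ) z r = sphereArea d * pev q z + sphereArea d * δ := by
    rw [← sphereInt_harmonic hq z hr, ← sphereInt_const δ z r]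
    exact integral_add (integrable_sphere (continuous_pev q) z r)
      (integrable_sphere continuous_const z r)
  have h3 : pev q z - δ ≤ w z := by
    refine hw z r hr (fun x => pev q x - δ) ((contDiff_pev q).sub contDiff_const) ?_ ?_ z
      (mem_ball_self hr)
    · intro x _
      rw [lapl_sub (contDiff_pev q).contDiffAt contDiffAt_const, lapl_const, lapl_pev, hq]
      simp [pev]
    · intro x hx
      have := (abs_lt.1 (hqw x hx)).2
      linarith
  have h4 : (2 * sphereArea d) * δ ≤ e := by
    rw [hδ, mul_div_assoc', div_le_iff₀ (by positivity)]
    nlinarith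
  nlinarith [mul_le_mul_of_nonneg_left h3 hA]

theorem setIntegral_ball_eq (w : Euc d → ℝ) (z : Euc d) (R : ℝ) :
    ∫ y in ball z R, w y = ∫ y : Euc d, (Iio R).indicator (fun _ => (1 : ℝ)) ‖y‖ * w (z + y) := by
  rw [← integral_indicator measurableSet_ball, ← integral_add_left_eq_self _ z]
  congr 1
  funext y
  by_cases hy : ‖y‖ < R
  · rw [indicator_of_mem (by simpa using hy), indicator_of_mem (mem_Iio.2 hy), one_mul]
  · rw [indicator_of_notMem (by simpa using hy), indicator_of_notMem (by simpa using hy), zero_mul]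

theorem integrable_weight_mul {φ : ℝ → ℝ} (hφ : Measurable φ) {M R : ℝ} (hM : ∀ r, |φ r| ≤ M)
    (hR : ∀ r, R < r → φ r = 0) {w : Euc d → ℝ} (hw : Continuous w) (z : Euc d) :
    Integrable fun y : Euc d => φ ‖y‖ * w (z + y) := by
  have h1 : IntegrableOn (fun y : Euc d => φ ‖y‖ * w (z + y)) (closedBall 0 R) := by
    refine Integrable.bdd_mul (c := M)
      ((by fun_prop : Continuous fun y : Euc d => w (z + y)).continuousOn.integrableOn_compact
        (isCompact_closedBall _ _)) (hφ.comp measurable_norm).aestronglyMeasurable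
      (Eventually.of_forall fun y => hM _)
  refine h1.integrable_of_forall_notMem_eq_zero fun y hy => ?_
  rw [hR _ (by simpa using hy), zero_mul]

/-- Radial averages of a superharmonic function. -/
theorem CompSuper.integral_weight_le [NeZero d] {w : Euc d → ℝ} (hw : CompSuper d w)
    (hc : Continuous w) (z : Euc d) {φ : ℝ → ℝ} (hφ : Measurable φ) (hφ0 : ∀ r, 0 ≤ φ r) {M R : ℝ}
    (hM : ∀ r, |φ r| ≤ M) (hR : ∀ r, R < r → φ r = 0) :
    ∫ y : Euc d, φ ‖y‖ * w (z + y) ≤ ∫ y : Euc d, φ ‖y‖ * w z := by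
  have hi := integrable_weight_mul hφ hM hR hc z
  have hi2 := integrable_weight_mul (w := fun _ : Euc d => w z) hφ hM hR continuous_const z
  rw [integral_norm_mul_eq hi, integral_norm_mul_eq (z := z) (w := fun _ : Euc d => w z) hi2]
  simp only [sphereInt_const]
  have key : ∀ g : ℝ → ℝ, Continuous g → IntegrableOn (fun r => r ^ (d - 1) * (φ r * g r)) (Ioi 0) := by
    intro g hg
    have h1 : IntegrableOn (fun r : ℝ => φ r * (r ^ (d - 1) * g r)) (Icc 0 R) :=
      Integrable.bdd_mul (c := M)
        ((by fun_prop : Continuous fun r : ℝ => r ^ (d - 1) * g r).continuousOn.integrableOn_compact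
          isCompact_Icc) hφ.aestronglyMeasurable (Eventually.of_forall fun y => hM _)
    have h2 := h1.of_forall_sdiff_eq_zero (t := Ioi 0) measurableSet_Ioi fun r hr => by
      rw [hR r (by
        by_contra h
        exact hr.2 ⟨(mem_Ioi.1 hr.1).le, not_lt.1 h⟩), zero_mul]
    exact h2.congr (Eventually.of_forall fun r => by ring)
  refine setIntegral_mono_on (key _ (continuous_sphereInt hc z)) (key _ continuous_const)
    measurableSet_Ioi fun r hr => ?_
  have := hw.sphereInt_le hc z (mem_Ioi.1 hr)
  have h0 := hφ0 r
  have h1 : 0 ≤ r ^ (d - 1) := pow_nonneg (mem_Ioi.1 hr).le _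
  gcongr

theorem CompSuper.setIntegral_ball_le [NeZero d] {w : Euc d → ℝ} (hw : CompSuper d w)
    (hc : Continuous w) (z : Euc d) (R : ℝ) :
    ∫ y in ball z R, w y ≤ ∫ _ in ball z R, w z := by
  rw [setIntegral_ball_eq, setIntegral_ball_eq]
  refine hw.integral_weight_le hc z (M := 1) (R := R)
    (measurable_const.indicator measurableSet_Iio) (fun r => indicator_nonneg (fun _ _ => zero_le_one) r) ?_ ?_
  · intro r
    by_cases h : r ∈ Iio R <;> simp [h]
  · intro r hr
    exact indicator_of_notMem (by simpa using hr.le) _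

theorem CompSuper.superMeanVal [NeZero d] {w : Euc d → ℝ} (hw : CompSuper d w) (hc : Continuous w) :
    SuperMeanVal d w := by
  intro z r hr
  have h := hw.setIntegral_ball_le hc z r
  have hv : 0 < (volume : Measure (Euc d)).real (ball z r) :=
    ENNReal.toReal_pos (measure_ball_pos _ _ hr).ne' measure_ball_lt_top.ne
  rw [setIntegral_const, smul_eq_mul] at h
  rw [setAverage_eq, smul_eq_mul, inv_mul_le_iff₀ hv]
  exact h

end SphereMean

section HarmonicLimits

variable {d : ℕ}

theorem compSuper_pev [NeZero d] {q : MvPolynomial (Fin d) ℝ} (hq : polyLapl d q = 0) :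
    CompSuper d (pev q) :=
  compSuper_of_touched_above (continuous_pev q) fun _ =>
    ⟨pev q, (contDiff_pev q).contDiffAt, rfl, Eventually.of_forall fun _ => le_rfl, by
      rw [lapl_pev, hq]; simp [pev]⟩

theorem polyLapl_neg (p : MvPolynomial (Fin d) ℝ) : polyLapl d (-p) = -polyLapl d p := by
  simp [polyLapl]

theorem pev_neg (p : MvPolynomial (Fin d) ℝ) (x : Euc d) : pev (-p) x = -pev p x := by
  simp [pev]

theorem integral_weight_pev [NeZero d] {q : MvPolynomial (Fin d) ℝ} (hq : polyLapl d q = 0)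
    (z : Euc d) {φ : ℝ → ℝ} (hφ : Measurable φ) (hφ0 : ∀ r, 0 ≤ φ r) {M R : ℝ}
    (hM : ∀ r, |φ r| ≤ M) (hR : ∀ r, R < r → φ r = 0) :
    ∫ y : Euc d, φ ‖y‖ * pev q (z + y) = ∫ y : Euc d, φ ‖y‖ * pev q z := by
  refine le_antisymm
    ((compSuper_pev hq).integral_weight_le (continuous_pev q) z hφ hφ0 hM hR) ?_
  have := (compSuper_pev (q := -q) (by rw [polyLapl_neg, hq, neg_zero])).integral_weight_le
    (continuous_pev _) z hφ hφ0 hM hR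
  simp only [pev_neg, mul_neg, integral_neg] at this
  linarith

theorem ContDiffAt.continuousAt_lapl {f : Euc d → ℝ} {x : Euc d} (hf : ContDiffAt ℝ 2 f x) :
    ContinuousAt (lapl d f) x := by
  unfold lapl
  refine tendsto_finsetSum _ fun i _ => ?_
  have h1 : ContDiffAt ℝ 1 (fderiv ℝ f) x := hf.fderiv_right (by norm_num)
  have h2 : ContDiffAt ℝ 1 (fun y => fderiv ℝ f y (EuclideanSpace.single i 1)) x :=
    h1.clm_apply contDiffAt_const
  have h3 : ContDiffAt ℝ 0
      (fderiv ℝ (fun y => fderiv ℝ f y (EuclideanSpace.single i 1))) x :=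
    h2.fderiv_right (by norm_num)
  exact (h3.clm_apply contDiffAt_const).continuousAt

/-- `v` is a uniform limit of harmonic polynomials on the set `s`. -/
def HarmonicLimitOn (d : ℕ) (v : Euc d → ℝ) (s : Set (Euc d)) : Prop :=
  ∀ δ > 0, ∃ q : MvPolynomial (Fin d) ℝ, polyLapl d q = 0 ∧ ∀ x ∈ s, |v x - pev q x| ≤ δ

theorem HarmonicLimitOn.neg {v : Euc d → ℝ} {s : Set (Euc d)} (h : HarmonicLimitOn d v s) :
    HarmonicLimitOn d (fun x => -v x) s := by
  intro δ hδ
  obtain ⟨q, hq, hv⟩ := h δ hδ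
  refine ⟨-q, by rw [polyLapl_neg, hq, neg_zero], fun x hx => ?_⟩
  rw [pev_neg, ← abs_neg]
  convert hv x hx using 2
  ring

theorem HarmonicLimitOn.lapl_nonpos [NeZero d] {v : Euc d → ℝ} {z : Euc d} {r : ℝ} (hr : 0 < r)
    (h : HarmonicLimitOn d v (ball z r)) (hv : ContDiffAt ℝ 2 v z) : lapl d v z ≤ 0 := by
  by_contra! hL
  have hd : (0 : ℝ) < d := Nat.cast_pos.mpr (NeZero.pos d)
  set L := lapl d v z
  have hev : ∀ᶠ x in 𝓝 z, ContDiffAt ℝ 2 v x ∧ L / 2 < lapl d v x ∧ x ∈ ball z r :=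
    (hv.eventually (by simp)).and ((hv.continuousAt_lapl.eventually (lt_mem_nhds (half_lt_self hL))).and
      (ball_mem_nhds z hr))
  obtain ⟨s, hs, hsb⟩ := Metric.nhds_basis_closedBall.mem_iff.1 hev
  set c : ℝ := L / (4 * d) with hc
  have hc0 : 0 < c := by positivity
  set δ : ℝ := c * s ^ 2 / 4 with hδ
  have hδ0 : 0 < δ := by positivity
  obtain ⟨q, hq, hvq⟩ := h δ hδ0
  have key := nonpos_of_touched_below (U := ball z s)
    (f := fun x => v x - (pev q x + (c * ‖x - z‖ ^ 2 + (δ - c * s ^ 2)))) isOpen_ball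
    isBounded_ball (fun x hx => ?_) (fun x hx => ?_) (fun x hx => ?_) z (mem_ball_self hs)
  · have := (abs_le.1 (hvq z (mem_ball_self hr))).1
    simp only [sub_self, norm_zero] at key
    have : 0 < c * s ^ 2 := by positivity
    rw [hδ] at *
    nlinarith
  · have h1 := (hsb (closure_ball_subset_closedBall hx)).1.continuousAt
    refine ContinuousAt.continuousWithinAt (h1.sub ?_)
    exact ((continuous_pev q).add (by fun_prop)).continuousAt
  · obtain ⟨h1, h2, -⟩ := hsb (ball_subset_closedBall hx)
    have e1 : ContDiffAt ℝ 2 (fun x : Euc d => c * ‖x - z‖ ^ 2) x :=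
      contDiffAt_const.mul (contDiff_normSq_sub z).contDiffAt
    have e2 := e1.add (contDiffAt_const (c := δ - c * s ^ 2))
    have e3 := (contDiff_pev q (k := 2)).contDiffAt (x := x)
    refine ⟨_, h1.sub (e3.add e2), rfl, Eventually.of_forall fun _ => le_rfl, ?_⟩
    change 0 ≤ lapl d (fun x => v x - (pev q x + (c * ‖x - z‖ ^ 2 + (δ - c * s ^ 2)))) x
    rw [lapl_sub h1 (e3.add e2), lapl_add e3 e2, lapl_add e1 contDiffAt_const, lapl_const,
      lapl_const_mul _ (contDiff_normSq_sub z).contDiffAt, lapl_normSq_sub, lapl_pev, hq]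
    have : c * (2 * d) = L / 2 := by rw [hc]; field_simp; ring
    rw [this]
    simp only [pev, map_zero]
    linarith
  · have hxs := frontier_ball_subset_sphere hx
    have hxb := (hsb (sphere_subset_closedBall hxs)).2.2
    have := (abs_le.1 (hvq x hxb)).2
    rw [mem_sphere, dist_eq_norm] at hxs
    simp only [hxs]
    linarith

theorem HarmonicLimitOn.lapl_eq_zero [NeZero d] {v : Euc d → ℝ} {z : Euc d} {r : ℝ} (hr : 0 < r)
    (h : HarmonicLimitOn d v (ball z r)) (hv : ContDiffAt ℝ 2 v z) : lapl d v z = 0 := by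
  refine le_antisymm (h.lapl_nonpos hr hv) ?_
  have := h.neg.lapl_nonpos hr hv.neg
  rw [lapl_neg hv] at this
  linarith

/-- A smooth radial cut-off of radius `s`. -/
def radialBump (s r : ℝ) : ℝ := Real.smoothTransition (1 - r ^ 2 / s ^ 2)

theorem radialBump_nonneg (s r : ℝ) : 0 ≤ radialBump s r := Real.smoothTransition.nonneg _

theorem abs_radialBump_le (s r : ℝ) : |radialBump s r| ≤ 1 := by
  rw [abs_of_nonneg (radialBump_nonneg s r)]
  exact Real.smoothTransition.le_one _

theorem radialBump_eq_zero {s r : ℝ} (hs : 0 < s) (hr : s ≤ r) : radialBump s r = 0 := by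
  refine Real.smoothTransition.zero_of_nonpos ?_
  rw [sub_nonpos, le_div_iff₀ (by positivity), one_mul]
  gcongr

theorem contDiff_radialBump (s : ℝ) : ContDiff ℝ 2 fun y : Euc d => radialBump s ‖y‖ := by
  have : ContDiff ℝ 2 fun y : Euc d => 1 - ‖y‖ ^ 2 / s ^ 2 :=
    contDiff_const.sub ((contDiff_norm_sq ℝ).div_const _)
  exact (Real.smoothTransition.contDiff (n := 2)).comp this

theorem continuous_radialBump (s : ℝ) : Continuous (radialBump s) :=
  Real.smoothTransition.continuous.comp (by fun_prop)

theorem hasCompactSupport_radialBump {s : ℝ} (hs : 0 < s) :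
    HasCompactSupport fun y : Euc d => radialBump s ‖y‖ := by
  refine HasCompactSupport.of_support_subset_isCompact (isCompact_closedBall (0 : Euc d) s) ?_
  intro y hy
  by_contra h
  rw [mem_closedBall_zero_iff, not_le] at h
  exact hy (radialBump_eq_zero hs h.le)

theorem contDiff_radialBump_average {v : Euc d → ℝ} (hv : Continuous v) {s : ℝ} (hs : 0 < s) :
    ContDiff ℝ 2 fun x : Euc d => ∫ y : Euc d, radialBump s ‖y‖ * v (x + y) := by
  have h := HasCompactSupport.contDiff_convolution_right (𝕜 := ℝ) (n := 2)
    (ContinuousLinearMap.lsmul ℝ ℝ) (hasCompactSupport_radialBump (d := d) hs)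
    (hv.locallyIntegrable (μ := volume)) (contDiff_radialBump s)
  have e : (fun x : Euc d => ∫ y : Euc d, radialBump s ‖y‖ * v (x + y)) =
      convolution v (fun y : Euc d => radialBump s ‖y‖) (ContinuousLinearMap.lsmul ℝ ℝ) volume := by
    funext x
    simp only [convolution, ContinuousLinearMap.lsmul_apply, smul_eq_mul]
    rw [← integral_add_left_eq_self (fun t => v t * radialBump s ‖x - t‖) x]
    congr 1
    funext y
    rw [sub_add_cancel_left, norm_neg, mul_comm]
  rw [e]
  exact h

theorem integral_radialBump_pos {s : ℝ} (hs : 0 < s) : 0 < ∫ y : Euc d, radialBump s ‖y‖ := by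
  have hc : Continuous fun y : Euc d => radialBump s ‖y‖ := (continuous_radialBump s).comp continuous_norm
  refine hc.integral_pos_of_hasCompactSupport_nonneg_nonzero (x := 0)
    (hasCompactSupport_radialBump hs) (fun y => radialBump_nonneg _ _) ?_
  simp only [norm_zero, radialBump]
  exact (Real.smoothTransition.pos_of_pos (by norm_num)).ne'

/-- Locally uniform limits of harmonic polynomials are smooth and harmonic. -/
theorem HarmonicLimitOn.harmonicAt [NeZero d] {v : Euc d → ℝ} (hv : Continuous v) {z : Euc d}
    {r : ℝ} (hr : 0 < r) (h : HarmonicLimitOn d v (ball z r)) :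
    ContDiffAt ℝ 2 v z ∧ lapl d v z = 0 := by
  suffices hC : ContDiffAt ℝ 2 v z from ⟨hC, h.lapl_eq_zero hr hC⟩
  set s := r / 2 with hs
  have hs0 : 0 < s := by positivity
  set c := ∫ y : Euc d, radialBump s ‖y‖ with hcdef
  have hc0 : 0 < c := integral_radialBump_pos hs0
  have hInt : ∀ (w : Euc d → ℝ), Continuous w → ∀ x, Integrable fun y : Euc d => radialBump s ‖y‖ * w (x + y) :=
    fun w hw x => integrable_weight_mul (continuous_radialBump s).measurable (abs_radialBump_le s)
      (fun r hr => radialBump_eq_zero hs0 hr.le) hw x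
  have key : ∀ x ∈ ball z s, ∫ y : Euc d, radialBump s ‖y‖ * v (x + y) = c * v x := by
    intro x hx
    refine eq_of_abs_sub_le_all fun e he => ?_
    set δ := e / (2 * c) with hδ
    have hδ0 : 0 < δ := by positivity
    obtain ⟨q, hq, hvq⟩ := h δ hδ0
    have hxr : x ∈ ball z r := ball_subset_ball (by linarith) hx
    have h1 := integral_weight_pev hq x (continuous_radialBump s).measurable (radialBump_nonneg s)
      (abs_radialBump_le s) (fun r hr => radialBump_eq_zero hs0 hr.le)
    rw [integral_mul_const] at h1
    have h2 : |(∫ y : Euc d, radialBump s ‖y‖ * v (x + y)) - c * pev q x| ≤ c * δ := by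
      rw [hcdef, ← h1, ← integral_sub (hInt v hv x) (hInt _ (continuous_pev q) x), ← integral_mul_const,
        ← Real.norm_eq_abs]
      refine (norm_integral_le_of_norm_le (g := fun y : Euc d => radialBump s ‖y‖ * δ) ?_ ?_)
      · simpa using hInt (fun _ => δ) continuous_const 0
      · refine Eventually.of_forall fun y => ?_
        rw [← mul_sub, norm_mul, Real.norm_eq_abs, Real.norm_eq_abs,
          abs_of_nonneg (radialBump_nonneg s _)]
        by_cases hy : ‖y‖ < s
        · refine mul_le_mul_of_nonneg_left (hvq _ ?_) (radialBump_nonneg s _)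
          rw [mem_ball, dist_eq_norm] at hx ⊢
          calc ‖x + y - z‖ = ‖(x - z) + y‖ := by congr 1; abel
            _ ≤ ‖x - z‖ + ‖y‖ := norm_add_le _ _
            _ < r := by linarith
        · rw [radialBump_eq_zero hs0 (not_lt.1 hy)]; simp
    have h3 : |c * pev q x - c * v x| ≤ c * δ := by
      rw [← mul_sub, abs_mul, abs_of_pos hc0, abs_sub_comm]
      exact mul_le_mul_of_nonneg_left (hvq x hxr) hc0.le
    have h4 : c * δ + c * δ = e := by rw [hδ]; field_simp; ring
    calc _ ≤ _ := abs_sub_le _ (c * pev q x) _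
      _ ≤ c * δ + c * δ := add_le_add h2 h3
      _ = e := h4
  have hC := (contDiff_const (c := c⁻¹)).mul (contDiff_radialBump_average hv hs0)
  refine hC.contDiffAt.congr_of_eventuallyEq ?_
  filter_upwards [ball_mem_nhds z hs0] with x hx
  rw [key x hx, inv_mul_cancel_left₀ hc0.ne']

end HarmonicLimits

section LeastSupersolution

variable {d : ℕ}

/-- Continuous superharmonic functions above `Φ`. -/
def superClass (Φ : Euc d → ℝ) : Set (Euc d → ℝ) :=
  {w | Continuous w ∧ CompSuper d w ∧ ∀ x, Φ x ≤ w x}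

/-- The least superharmonic majorant of `Φ`. -/
def leastSuper (Φ : Euc d → ℝ) (x : Euc d) : ℝ := sInf ((fun w => w x) '' superClass Φ)

theorem compSuper_const [NeZero d] (c : ℝ) : CompSuper d fun _ => c :=
  compSuper_of_touched_above continuous_const fun z =>
    ⟨fun _ => c, contDiffAt_const, rfl, Eventually.of_forall fun _ => le_rfl, (lapl_const c z).le⟩

theorem leastSuper_le {Φ w : Euc d → ℝ} (hw : w ∈ superClass Φ) (x : Euc d) :
    leastSuper Φ x ≤ w x := by
  refine csInf_le ⟨Φ x, ?_⟩ ⟨w, hw, rfl⟩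
  rintro _ ⟨g, hg, rfl⟩
  exact hg.2.2 x

/-- Hypotheses on the obstacle: uniformly continuous with values in `[0, 1]`. -/
structure IsObstacle (Φ : Euc d → ℝ) : Prop where
  uniform : UniformContinuous Φ
  nonneg : ∀ x, 0 ≤ Φ x
  le_one : ∀ x, Φ x ≤ 1

variable {Φ : Euc d → ℝ}

theorem IsObstacle.one_mem [NeZero d] (h : IsObstacle Φ) : (fun _ => 1) ∈ superClass Φ :=
  ⟨continuous_const, compSuper_const 1, h.le_one⟩

theorem IsObstacle.le_leastSuper_of [NeZero d] (h : IsObstacle Φ) {x : Euc d} {c : ℝ}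
    (hc : ∀ w ∈ superClass Φ, c ≤ w x) : c ≤ leastSuper Φ x := by
  refine le_csInf ⟨_, _, h.one_mem, rfl⟩ ?_
  rintro _ ⟨g, hg, rfl⟩
  exact hc g hg

theorem IsObstacle.le_leastSuper [NeZero d] (h : IsObstacle Φ) (x : Euc d) :
    Φ x ≤ leastSuper Φ x := h.le_leastSuper_of fun _ hw => hw.2.2 x

theorem IsObstacle.leastSuper_nonneg [NeZero d] (h : IsObstacle Φ) (x : Euc d) :
    0 ≤ leastSuper Φ x := (h.nonneg x).trans (h.le_leastSuper x)

theorem IsObstacle.leastSuper_le_one [NeZero d] (h : IsObstacle Φ) (x : Euc d) :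
    leastSuper Φ x ≤ 1 := leastSuper_le h.one_mem x

theorem IsObstacle.compSuper [NeZero d] (h : IsObstacle Φ) : CompSuper d (leastSuper Φ) :=
  fun z r hr g hg hl hs x hx => h.le_leastSuper_of fun _ hw =>
    hw.2.1 z r hr g hg hl (fun y hy => (hs y hy).trans (leastSuper_le hw y)) x hx

theorem IsObstacle.continuous [NeZero d] (h : IsObstacle Φ) : Continuous (leastSuper Φ) := by
  have key : ∀ e > 0, ∃ δ > 0, ∀ x y : Euc d, dist x y < δ →
      leastSuper Φ x ≤ leastSuper Φ y + e := by
    intro e he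
    obtain ⟨δ, hδ, hd⟩ := Metric.uniformContinuous_iff.1 h.uniform e he
    refine ⟨δ, hδ, fun x y hxy => ?_⟩
    rw [← sub_le_iff_le_add]
    refine h.le_leastSuper_of fun w hw => ?_
    have hmem : (fun u => w (u + (y - x)) + e) ∈ superClass Φ := by
      refine ⟨(hw.1.comp (by fun_prop)).add continuous_const,
        (hw.2.1.translate (y - x)).add_const e, fun u => ?_⟩
      have h1 : dist u (u + (y - x)) < δ := by
        rw [dist_eq_norm] at hxy ⊢
        convert hxy using 2
        abel
      have h2 := (abs_lt.1 (hd h1)).2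
      have h3 := hw.2.2 (u + (y - x))
      linarith
    have := leastSuper_le hmem x
    simp only [add_sub_cancel] at this
    linarith
  refine Metric.continuous_iff.2 fun x e he => ?_
  obtain ⟨δ, hδ, hd⟩ := key (e / 2) (by positivity)
  refine ⟨δ, hδ, fun y hy => ?_⟩
  have h1 := hd y x hy
  have h2 := hd x y (by rwa [dist_comm])
  rw [Real.dist_eq, abs_lt]
  constructor <;> linarith

theorem IsObstacle.harmonicLimitOn [NeZero d] (h : IsObstacle Φ) {z : Euc d}
    (hz : Φ z < leastSuper Φ z) : ∃ r > 0, HarmonicLimitOn d (leastSuper Φ) (ball z r) := by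
  obtain ⟨c, hc1, hc2⟩ := exists_between hz
  have hev : ∀ᶠ x in 𝓝 z, Φ x < c ∧ c < leastSuper Φ x :=
    (h.uniform.continuous.continuousAt.eventually (gt_mem_nhds hc1)).and
      (h.continuous.continuousAt.eventually (lt_mem_nhds hc2))
  obtain ⟨r, hr, hrb⟩ := Metric.nhds_basis_closedBall.mem_iff.1 hev
  refine ⟨r, hr, fun δ hδ => ?_⟩
  obtain ⟨q, hq, hqv⟩ := exists_harmonic_near_on_sphere z hr h.continuous hδ
  refine ⟨q, hq, ?_⟩
  have hlow : ∀ x ∈ ball z r, c - δ ≤ pev q x := by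
    intro x hx
    have := pev_le_of_le_sphere (p := -q) (z := z) (r := r) (c := δ - c)
      (by rw [polyLapl_neg, hq, neg_zero]) (fun y hy => by
        have h1 := (abs_lt.1 (hqv y hy)).1
        have h2 := (hrb (sphere_subset_closedBall hy)).2
        rw [pev_neg]; linarith) x hx
    rw [pev_neg] at this
    linarith
  have hfr : ∀ x ∈ frontier (ball z r), leastSuper Φ x ≤ pev q x + δ := fun x hx => by
    have := (abs_lt.1 (hqv x (frontier_ball_subset_sphere hx))).1
    linarith
  have hg : ContDiff ℝ 2 fun x => pev q x + δ := (contDiff_pev q).add contDiff_const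
  have hmem : glueMin (ball z r) (leastSuper Φ) (fun x => pev q x + δ) ∈ superClass Φ := by
    refine ⟨continuous_glueMin h.continuous hg.continuous hfr,
      compSuper_glueMin isOpen_ball h.compSuper hg (fun x _ => ?_) hfr, fun x => ?_⟩
    · rw [lapl_add (contDiff_pev q).contDiffAt contDiffAt_const, lapl_const, lapl_pev, hq]
      simp [pev]
    · by_cases hx : x ∈ ball z r
      · rw [glueMin_of_mem _ _ hx]
        refine le_min (h.le_leastSuper x) ?_
        have h1 := hlow x hx
        have h2 := (hrb (ball_subset_closedBall hx)).1
        linarith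
      · rw [glueMin_of_notMem _ _ hx]
        exact h.le_leastSuper x
  intro x hx
  have h1 := leastSuper_le hmem x
  rw [glueMin_of_mem _ _ hx] at h1
  have h2 := h1.trans (min_le_right _ _)
  have h3 := h.compSuper z r hr (fun x => pev q x - δ) ((contDiff_pev q).sub contDiff_const)
    (fun y _ => by
      rw [lapl_sub (contDiff_pev q).contDiffAt contDiffAt_const, lapl_const, lapl_pev, hq]
      simp [pev])
    (fun y hy => by
      have := (abs_lt.1 (hqv y hy)).2
      linarith) x hx
  rw [abs_le]
  constructor <;> linarith

theorem IsObstacle.harmonicAt [NeZero d] (h : IsObstacle Φ) {z : Euc d}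
    (hz : Φ z < leastSuper Φ z) :
    ContDiffAt ℝ 2 (leastSuper Φ) z ∧ lapl d (leastSuper Φ) z = 0 := by
  obtain ⟨r, hr, hH⟩ := h.harmonicLimitOn hz
  exact hH.harmonicAt h.continuous hr

theorem IsObstacle.leastSuper_pos [NeZero d] (h : IsObstacle Φ) {x₀ : Euc d} (h0 : 0 < Φ x₀)
    (z : Euc d) : 0 < leastSuper Φ z := by
  by_contra! hz
  have hz0 : leastSuper Φ z = 0 := le_antisymm hz (h.leastSuper_nonneg z)
  set R := dist x₀ z + 1
  have hx : x₀ ∈ ball z R := by rw [mem_ball]; linarith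
  have h1 := h.compSuper.setIntegral_ball_le h.continuous z R
  rw [hz0, setIntegral_const, smul_zero] at h1
  refine absurd h1 (not_le.2 ?_)
  have hi : IntegrableOn (leastSuper Φ) (ball z R) :=
    (h.continuous.continuousOn.integrableOn_compact (isCompact_closedBall z R)).mono_set
      ball_subset_closedBall
  rw [setIntegral_pos_iff_support_of_nonneg_ae
    (Eventually.of_forall fun x => h.leastSuper_nonneg x) hi]
  refine (h.continuous.isOpen_support.inter isOpen_ball).measure_pos volume ⟨x₀, ?_, hx⟩
  exact (h0.trans_le (h.le_leastSuper x₀)).ne'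

theorem lapl_comp_sign (R : Euc d ≃L[ℝ] Euc d) (s : Fin d → ℝ) (hs : ∀ i, s i * s i = 1)
    (hR : ∀ i, R (coordVec i) = s i • coordVec i) (h : Euc d → ℝ) (x : Euc d) :
    lapl d (fun y => h (R y)) x = lapl d h (R x) := by
  unfold lapl
  refine Finset.sum_congr rfl fun i _ => ?_
  have h1 : ∀ (g : Euc d → ℝ) (y : Euc d), fderiv ℝ (fun y => g (R y)) y (coordVec i) =
      s i * fderiv ℝ g (R y) (coordVec i) := by
    intro g y
    have := R.comp_right_fderiv (f := g) (x := y)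
    change fderiv ℝ (g ∘ R) y (coordVec i) = _
    rw [this]
    simp only [ContinuousLinearMap.comp_apply, ContinuousLinearEquiv.coe_coe]
    rw [hR, map_smul, smul_eq_mul]
  have h2 : (fun y => fderiv ℝ (fun y => h (R y)) y (coordVec i)) =
      fun y => (fun u => s i * fderiv ℝ h u (coordVec i)) (R y) := by
    funext y
    rw [h1]
  refine (congrArg (fun g : Euc d → ℝ => fderiv ℝ g x (coordVec i)) h2).trans ?_
  rw [h1 (fun u => s i * fderiv ℝ h u (coordVec i)) x]
  have h3 : (fun u => s i * fderiv ℝ h u (coordVec i)) = s i • fun u => fderiv ℝ h u (coordVec i) := rfl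
  rw [h3, fderiv_const_smul_field]
  simp only [Pi.smul_apply, smul_apply, smul_eq_mul]
  rw [← mul_assoc, hs, one_mul]

/-- Reflection in the coordinate hyperplane `x_i = 0`. -/
def coordReflection (i : Fin d) : Euc d ≃ₗᵢ[ℝ] Euc d :=
  LinearIsometryEquiv.piLpCongrRight 2
    (fun j => if j = i then LinearIsometryEquiv.neg ℝ else LinearIsometryEquiv.refl ℝ ℝ)

theorem coordReflection_apply (i : Fin d) (x : Euc d) (j : Fin d) :
    coordReflection i x j = if j = i then -x j else x j := by
  simp only [coordReflection, LinearIsometryEquiv.piLpCongrRight_apply]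
  split_ifs <;> simp

theorem coordReflection_coordReflection (i : Fin d) (x : Euc d) :
    coordReflection i (coordReflection i x) = x := by
  ext j
  simp only [coordReflection_apply]
  split_ifs <;> simp

theorem lapl_comp_coordReflection (i : Fin d) (h : Euc d → ℝ) (x : Euc d) :
    lapl d (fun y => h (coordReflection i y)) x = lapl d h (coordReflection i x) := by
  refine lapl_comp_sign (coordReflection i).toContinuousLinearEquiv
    (fun j => if j = i then -1 else 1) (fun j => by split_ifs <;> norm_num) (fun j => ?_) h x
  ext k
  change coordReflection i (coordVec j) k = _
  rw [coordReflection_apply]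
  by_cases hk : k = j
  · subst hk
    by_cases hi : k = i <;> simp [hi]
  · by_cases hj : j = i <;> by_cases hi : k = i <;> simp_all

theorem CompSuper.comp_coordReflection {w : Euc d → ℝ} (hw : CompSuper d w) (i : Fin d) :
    CompSuper d fun x => w (coordReflection i x) := by
  intro z r hr h hh hl hs x hx
  have hmem : ∀ y, dist (coordReflection i y) z = dist y (coordReflection i z) := fun y => by
    rw [← (coordReflection i).dist_map y, coordReflection_coordReflection]
  have := hw (coordReflection i z) r hr (fun y => h (coordReflection i y))
    (hh.comp (coordReflection i).contDiff)
    (fun y hy => by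
      rw [lapl_comp_coordReflection]
      exact hl _ (by rwa [mem_ball, hmem]))
    (fun y hy => by
      have := hs (coordReflection i y) (by rwa [mem_sphere, hmem])
      simpa only [coordReflection_coordReflection] using this)
    (coordReflection i x) (by rwa [mem_ball, (coordReflection i).dist_map])
  rwa [coordReflection_coordReflection] at this

theorem IsObstacle.leastSuper_coordReflection [NeZero d] (h : IsObstacle Φ) {i : Fin d}
    (hΦ : ∀ x, Φ (coordReflection i x) = Φ x) (x : Euc d) :
    leastSuper Φ (coordReflection i x) = leastSuper Φ x := by
  have key : ∀ x, leastSuper Φ x ≤ leastSuper Φ (coordReflection i x) := by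
    intro x
    refine leastSuper_le (w := fun x => leastSuper Φ (coordReflection i x))
      ⟨h.continuous.comp (coordReflection i).continuous, h.compSuper.comp_coordReflection i,
        fun y => ?_⟩ x
    rw [← hΦ y]
    exact h.le_leastSuper _
  refine le_antisymm ?_ (key x)
  have := key (coordReflection i x)
  rwa [coordReflection_coordReflection] at this

end LeastSupersolution

section ThinSpace

variable {n : ℕ}

theorem thinProj_apply (x : Euc (n + 1)) (i : Fin n) : thinProj n x i = x i.castSucc := rfl

theorem thinEmbed_last (x' : Euc n) (t : ℝ) : thinEmbed n x' t (Fin.last n) = t := by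
  simp [thinEmbed]

theorem thinProj_thinEmbed (x' : Euc n) (t : ℝ) : thinProj n (thinEmbed n x' t) = x' := by
  ext i
  simp [thinProj_apply, thinEmbed]

theorem thinEmbed_thinProj (x : Euc (n + 1)) : thinEmbed n (thinProj n x) (x (Fin.last n)) = x := by
  ext i
  refine Fin.lastCases ?_ (fun i => ?_) i
  · rw [thinEmbed_last]
  · rw [← thinProj_apply, thinProj_thinEmbed, thinProj_apply]

theorem norm_sq_eq_thin (x : Euc (n + 1)) : ‖x‖ ^ 2 = ‖thinProj n x‖ ^ 2 + x (Fin.last n) ^ 2 := by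
  rw [EuclideanSpace.norm_sq_eq, EuclideanSpace.norm_sq_eq, Fin.sum_univ_castSucc]
  simp [thinProj_apply]

theorem continuous_thinProj : Continuous (thinProj n) :=
  (EuclideanSpace.equiv (Fin n) ℝ).symm.continuous.comp (by fun_prop)

theorem coordReflection_thinEmbed (x' : Euc n) (t : ℝ) :
    coordReflection (Fin.last n) (thinEmbed n x' t) = thinEmbed n x' (-t) := by
  ext i
  rw [coordReflection_apply]
  refine Fin.lastCases ?_ (fun i => ?_) i
  · simp [thinEmbed_last]
  · simp [thinEmbed, (Fin.castSucc_lt_last i).ne]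

theorem thinProj_coordReflection (x : Euc (n + 1)) :
    thinProj n (coordReflection (Fin.last n) x) = thinProj n x := by
  ext i
  rw [thinProj_apply, coordReflection_apply, thinProj_apply, if_neg (Fin.castSucc_lt_last i).ne]

/-- A polynomial on `ℝ^n` viewed as a polynomial on `ℝ^{n+1}`. -/
def liftPoly (n : ℕ) (p : MvPolynomial (Fin n) ℝ) : MvPolynomial (Fin (n + 1)) ℝ :=
  MvPolynomial.rename Fin.castSucc p

theorem pev_liftPoly (p : MvPolynomial (Fin n) ℝ) (x : Euc (n + 1)) :
    pev (liftPoly n p) x = pev p (thinProj n x) := by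
  simp only [pev, liftPoly, MvPolynomial.eval_rename]
  rfl

theorem pderiv_last_liftPoly (p : MvPolynomial (Fin n) ℝ) :
    MvPolynomial.pderiv (Fin.last n) (liftPoly n p) = 0 := by
  refine MvPolynomial.pderiv_eq_zero_of_notMem_vars fun h => ?_
  have := MvPolynomial.vars_rename Fin.castSucc p h
  rw [Finset.mem_image] at this
  obtain ⟨i, -, hi⟩ := this
  exact (Fin.castSucc_lt_last i).ne hi

theorem pderiv_castSucc_liftPoly (p : MvPolynomial (Fin n) ℝ) (i : Fin n) :
    MvPolynomial.pderiv i.castSucc (liftPoly n p) = liftPoly n (MvPolynomial.pderiv i p) :=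
  MvPolynomial.pderiv_rename (Fin.castSucc_injective n) i p

theorem polyLapl_liftPoly (p : MvPolynomial (Fin n) ℝ) :
    polyLapl (n + 1) (liftPoly n p) = liftPoly n (polyLapl n p) := by
  simp only [polyLapl, Fin.sum_univ_castSucc, pderiv_castSucc_liftPoly, pderiv_last_liftPoly,
    map_zero, add_zero]
  simp [liftPoly]

/-- The sum of a polynomial in `x'` and a quadratic polynomial in the last variable. -/
def slabPoly (n : ℕ) (p : MvPolynomial (Fin n) ℝ) (α β : ℝ) : MvPolynomial (Fin (n + 1)) ℝ :=
  liftPoly n p + MvPolynomial.C α * MvPolynomial.X (Fin.last n) +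
    MvPolynomial.C β * MvPolynomial.X (Fin.last n) ^ 2

theorem pev_slabPoly (p : MvPolynomial (Fin n) ℝ) (α β : ℝ) (x : Euc (n + 1)) :
    pev (slabPoly n p α β) x =
      pev p (thinProj n x) + α * x (Fin.last n) + β * x (Fin.last n) ^ 2 := by
  rw [← pev_liftPoly]
  simp [slabPoly, pev]

theorem lapl_slabPoly (p : MvPolynomial (Fin n) ℝ) (α β : ℝ) (x : Euc (n + 1)) :
    lapl (n + 1) (pev (slabPoly n p α β)) x = pev (polyLapl n p) (thinProj n x) + 2 * β := by
  have h : polyLapl (n + 1) (slabPoly n p α β) =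
      liftPoly n (polyLapl n p) + MvPolynomial.C (2 * β) := by
    rw [slabPoly, polyLapl_add, polyLapl_add, polyLapl_liftPoly]
    have h1 : polyLapl (n + 1) (MvPolynomial.C α * MvPolynomial.X (Fin.last n)) = 0 := by
      simp only [polyLapl, Derivation.leibniz, MvPolynomial.pderiv_C, MvPolynomial.pderiv_X,
        smul_eq_mul, mul_zero, add_zero]
      refine Finset.sum_eq_zero fun i _ => ?_
      by_cases hi : i = Fin.last n
      · subst hi; simp
      · simp [Ne.symm hi]
    have h2 : polyLapl (n + 1) (MvPolynomial.C β * MvPolynomial.X (Fin.last n) ^ 2) =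
        MvPolynomial.C (2 * β) := by
      simp only [polyLapl, Fin.sum_univ_castSucc, Derivation.leibniz, MvPolynomial.pderiv_C,
        MvPolynomial.pderiv_X, smul_eq_mul, mul_zero, add_zero, MvPolynomial.pderiv_pow]
      have h3 : MvPolynomial.pderiv (Fin.last n) (2 : MvPolynomial (Fin (n + 1)) ℝ) = 0 := by
        exact_mod_cast (MvPolynomial.pderiv (R := ℝ) (Fin.last n)).map_natCast 2
      simp [(Fin.castSucc_lt_last _).ne', h3]
      have h4 : (MvPolynomial.C 2 : MvPolynomial (Fin (n + 1)) ℝ) = 2 := map_ofNat _ 2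
      rw [h4]
      ring
    rw [h1, h2, add_zero]
  rw [lapl_pev, h, pev_add, pev_liftPoly, pev_C]

end ThinSpace

section SlabObstacle

variable {n : ℕ}

/-- The obstacle used to build the solution: it is supported in the slab `|x_{n+1}| ≤ t`. -/
def slabObstacle (ψ : MvPolynomial (Fin n) ℝ) (A t : ℝ) (x : Euc (n + 1)) : ℝ :=
  max 0 (pev ψ (thinProj n x) + A * max (t - |x (Fin.last n)|) 0 ^ 2 - A * t ^ 2)

/-- Conditions on the data of `slabObstacle`. -/
structure SlabData (ψ : MvPolynomial (Fin n) ℝ) (ρ A t : ℝ) : Prop where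
  t_pos : 0 < t
  height : 1 ≤ A * t ^ 2
  lapl_ge : ∀ x' : Euc n, ‖x'‖ ≤ ρ → 1 ≤ pev (polyLapl n ψ) x' + 2 * A
  le_one : ∀ x' : Euc n, pev ψ x' ≤ 1
  nonpos : ∀ x' : Euc n, ρ ≤ ‖x'‖ → pev ψ x' ≤ 0

variable {ψ : MvPolynomial (Fin n) ℝ} {ρ A t : ℝ}

theorem SlabData.A_pos (h : SlabData ψ ρ A t) : 0 < A := by
  have := h.height
  have := h.t_pos
  by_contra! hA
  nlinarith [mul_nonneg_of_nonpos_of_nonpos hA hA, sq_nonneg t]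

theorem slabObstacle_of_abs_le {x : Euc (n + 1)} (hx : |x (Fin.last n)| ≤ t) :
    slabObstacle ψ A t x = max 0 (pev ψ (thinProj n x) - 2 * A * t * |x (Fin.last n)| +
      A * x (Fin.last n) ^ 2) := by
  rw [slabObstacle, max_eq_left (sub_nonneg.2 hx), ← sq_abs (x (Fin.last n))]
  congr 1
  ring

theorem SlabData.slabObstacle_eq_zero (h : SlabData ψ ρ A t) {x : Euc (n + 1)}
    (hx : t ≤ |x (Fin.last n)|) : slabObstacle ψ A t x = 0 := by
  rw [slabObstacle, max_eq_right (sub_nonpos.2 hx)]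
  refine max_eq_left ?_
  linarith [h.height, h.le_one (thinProj n x)]

theorem SlabData.slabObstacle_le (h : SlabData ψ ρ A t) {x : Euc (n + 1)} {c : ℝ} (hc : 0 ≤ c)
    (hx : ‖thinProj n x‖ < ρ → |x (Fin.last n)| ≤ t →
      pev ψ (thinProj n x) - A * t * |x (Fin.last n)| ≤ c) : slabObstacle ψ A t x ≤ c := by
  rcases le_total t |x (Fin.last n)| with ht | ht
  · rwa [h.slabObstacle_eq_zero ht]
  rw [slabObstacle_of_abs_le ht]
  refine max_le hc ?_
  have hA := h.A_pos
  have h0 := abs_nonneg (x (Fin.last n))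
  have h1 : A * x (Fin.last n) ^ 2 ≤ A * t * |x (Fin.last n)| := by
    rw [← sq_abs, mul_assoc, sq]
    gcongr
  have h2 : 0 ≤ A * t * |x (Fin.last n)| := by have := h.t_pos; positivity
  rcases lt_or_ge ‖thinProj n x‖ ρ with hρ | hρ
  · linarith [hx hρ ht]
  · linarith [h.nonpos _ hρ]

theorem SlabData.slabObstacle_eq_zero_of_norm (h : SlabData ψ ρ A t) {x : Euc (n + 1)}
    (hx : ρ ≤ ‖thinProj n x‖) : slabObstacle ψ A t x = 0 :=
  le_antisymm (h.slabObstacle_le le_rfl fun h' => absurd hx h'.not_ge) (le_max_left _ _)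

theorem slabObstacle_thinEmbed (ht : 0 < t) (x' : Euc n) :
    slabObstacle ψ A t (thinEmbed n x' 0) = max 0 (pev ψ x') := by
  rw [slabObstacle_of_abs_le (by simpa [thinEmbed_last] using ht.le)]
  simp [thinEmbed_last, thinProj_thinEmbed]

theorem continuous_slabObstacle : Continuous (slabObstacle ψ A t) := by
  have h1 : Continuous fun x : Euc (n + 1) => pev ψ (thinProj n x) :=
    (continuous_pev ψ).comp continuous_thinProj
  unfold slabObstacle
  fun_prop

theorem SlabData.isObstacle (h : SlabData ψ ρ A t) : IsObstacle (slabObstacle ψ A t) where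
  uniform := by
    refine HasCompactSupport.uniformContinuous_of_continuous ?_ continuous_slabObstacle
    refine HasCompactSupport.of_support_subset_isCompact
      (isCompact_closedBall (0 : Euc (n + 1)) (|ρ| + t)) fun x hx => ?_
    have ht := h.t_pos
    have h1 : |x (Fin.last n)| < t := by
      by_contra! hc
      exact hx (h.slabObstacle_eq_zero hc)
    have h2 : ‖thinProj n x‖ < ρ := by
      by_contra! hc
      exact hx (h.slabObstacle_eq_zero_of_norm hc)
    have h3 := le_abs_self ρ
    have h4 : ‖thinProj n x‖ ^ 2 ≤ |ρ| ^ 2 := by gcongr; linarith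
    have h5 : x (Fin.last n) ^ 2 ≤ t ^ 2 := by rw [← sq_abs]; gcongr
    rw [mem_closedBall_zero_iff]
    refine le_of_sq_le_sq ?_ (by positivity)
    rw [norm_sq_eq_thin]
    nlinarith [abs_nonneg ρ]
  nonneg x := le_max_left _ _
  le_one x := h.slabObstacle_le zero_le_one fun _ _ => by
    have := h.A_pos
    have := h.t_pos
    have : 0 ≤ A * t * |x (Fin.last n)| := by positivity
    linarith [h.le_one (thinProj n x)]

theorem slabObstacle_coordReflection (x : Euc (n + 1)) :
    slabObstacle ψ A t (coordReflection (Fin.last n) x) = slabObstacle ψ A t x := by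
  simp [slabObstacle, thinProj_coordReflection, coordReflection_apply]

theorem SlabData.lt_leastSuper (h : SlabData ψ ρ A t) {z : Euc (n + 1)}
    (hz : z (Fin.last n) ≠ 0) (hpos : 0 < leastSuper (slabObstacle ψ A t) z) :
    slabObstacle ψ A t z < leastSuper (slabObstacle ψ A t) z := by
  refine (h.isObstacle.le_leastSuper z).lt_of_ne fun heq => ?_
  have hΦ : 0 < slabObstacle ψ A t z := heq ▸ hpos
  have ht : |z (Fin.last n)| < t := by
    by_contra! hc
    exact hΦ.ne' (h.slabObstacle_eq_zero hc)
  have hρ : ‖thinProj n z‖ < ρ := by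
    by_contra! hc
    exact hΦ.ne' (h.slabObstacle_eq_zero_of_norm hc)
  obtain ⟨s, hs⟩ : ∃ s : ℝ, ∀ᶠ x in 𝓝 z, |x (Fin.last n)| = s * x (Fin.last n) := by
    have hc : Continuous fun x : Euc (n + 1) => x (Fin.last n) := by fun_prop
    rcases hz.lt_or_gt with hn | hp
    · refine ⟨-1, ?_⟩
      filter_upwards [hc.continuousAt.eventually (gt_mem_nhds hn)] with x hx
      rw [abs_of_neg hx, neg_one_mul]
    · refine ⟨1, ?_⟩
      filter_upwards [hc.continuousAt.eventually (lt_mem_nhds hp)] with x hx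
      rw [abs_of_pos hx, one_mul]
  set Ψ := slabPoly n ψ (-(2 * A * t * s)) A with hΨ
  have hev : ∀ᶠ x in 𝓝 z, |x (Fin.last n)| = s * x (Fin.last n) ∧ |x (Fin.last n)| < t ∧
      ‖thinProj n x‖ < ρ := by
    have hc1 : Continuous fun x : Euc (n + 1) => |x (Fin.last n)| := by fun_prop
    exact hs.and ((hc1.continuousAt.eventually (gt_mem_nhds ht)).and
      (continuous_thinProj.norm.continuousAt.eventually (gt_mem_nhds hρ)))
  have heval : ∀ x : Euc (n + 1), |x (Fin.last n)| = s * x (Fin.last n) →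
      |x (Fin.last n)| < t → slabObstacle ψ A t x = max 0 (pev Ψ x) := by
    intro x h1 h2
    rw [slabObstacle_of_abs_le h2.le, hΨ, pev_slabPoly, h1]
    congr 1
    ring
  obtain ⟨r, hr, hb⟩ := Metric.nhds_basis_closedBall.mem_iff.1 hev
  set δ : ℝ := 1 / (2 * (n + 1))
  have hδ : 0 < δ := by positivity
  have hz' := hb (mem_closedBall_self hr.le)
  have hsm : ContDiff ℝ 2 fun x : Euc (n + 1) => pev Ψ x - δ * ‖x - z‖ ^ 2 :=
    (contDiff_pev Ψ).sub (contDiff_const.mul (contDiff_normSq_sub z))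
  have key := h.isObstacle.compSuper z r hr
    (fun x => pev Ψ x - δ * ‖x - z‖ ^ 2 + δ * r ^ 2) (hsm.add contDiff_const) (fun x hx => ?_)
    (fun x hx => ?_) z (mem_ball_self hr)
  · rw [← heq, heval z hz'.1 hz'.2.1, max_eq_right] at key
    · have : 0 < δ * r ^ 2 := by positivity
      simp at key
      linarith
    · rw [heval z hz'.1 hz'.2.1] at hΦ
      exact (lt_max_iff.1 hΦ).elim (fun h => absurd h (lt_irrefl _)) le_of_lt
  · have hx' := hb (ball_subset_closedBall hx)
    rw [lapl_add hsm.contDiffAt contDiffAt_const, lapl_const,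
      lapl_sub (contDiff_pev Ψ).contDiffAt (contDiff_const.mul (contDiff_normSq_sub z)).contDiffAt,
      lapl_const_mul δ (contDiff_normSq_sub z).contDiffAt, lapl_normSq_sub, hΨ, lapl_slabPoly]
    have h1 := h.lapl_ge _ hx'.2.2.le
    have h2 : δ * (2 * ((n + 1 : ℕ) : ℝ)) = 1 := by
      simp only [δ]
      push_cast
      field_simp
    linarith
  · have hx' := hb (sphere_subset_closedBall hx)
    refine le_trans ?_ (h.isObstacle.le_leastSuper x)
    rw [heval x hx'.1 hx'.2.1, ← dist_eq_norm, mem_sphere.1 hx]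
    simp

end SlabObstacle

section Barrier

theorem fderiv_comp_normSq_sub {d : ℕ} {F : ℝ → ℝ} {F' : ℝ} {p y : Euc d}
    (h : HasDerivAt F F' (‖y - p‖ ^ 2)) (i : Fin d) :
    fderiv ℝ (fun x => F (‖x - p‖ ^ 2)) y (coordVec i) = F' * (2 * (y i - p i)) := by
  have h1 := ((hasFDerivAt_id (𝕜 := ℝ) y).sub_const p).norm_sq
  have h2 := h.comp_hasFDerivAt y h1
  have h3 : fderiv ℝ (fun x => F (‖x - p‖ ^ 2)) y = _ := h2.fderiv
  rw [h3]
  simp [EuclideanSpace.inner_single_right]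

theorem lapl_comp_normSq_sub {d : ℕ} {F F₁ : ℝ → ℝ} {F₂ : ℝ} {p z : Euc d}
    (h1 : ∀ᶠ s in 𝓝 (‖z - p‖ ^ 2), HasDerivAt F (F₁ s) s)
    (h2 : HasDerivAt F₁ F₂ (‖z - p‖ ^ 2)) :
    lapl d (fun x => F (‖x - p‖ ^ 2)) z =
      4 * ‖z - p‖ ^ 2 * F₂ + 2 * d * F₁ (‖z - p‖ ^ 2) := by
  have hc : Continuous fun y : Euc d => ‖y - p‖ ^ 2 := by fun_prop
  have h3 : ∀ i : Fin d, fderiv ℝ (fun y => fderiv ℝ (fun x => F (‖x - p‖ ^ 2)) y (coordVec i)) z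
      (coordVec i) = F₁ (‖z - p‖ ^ 2) * 2 + F₂ * 4 * (z i - p i) ^ 2 := by
    intro i
    have he : (fun y => fderiv ℝ (fun x => F (‖x - p‖ ^ 2)) y (coordVec i)) =ᶠ[𝓝 z]
        fun y => F₁ (‖y - p‖ ^ 2) * (2 * (y i - p i)) := by
      filter_upwards [hc.continuousAt.eventually h1] with y hy
      exact fderiv_comp_normSq_sub hy i
    rw [he.fderiv_eq]
    have h4 := ((hasFDerivAt_id (𝕜 := ℝ) z).sub_const p).norm_sq
    have h5 := h2.comp_hasFDerivAt z h4
    have h6 := ((hasFDerivAt_coord i z).sub_const (p i)).const_mul 2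
    have h7 : fderiv ℝ (fun y : Euc d => F₁ (‖y - p‖ ^ 2) * (2 * (y i - p i))) z = _ :=
      (h5.mul h6).fderiv
    rw [h7]
    simp [EuclideanSpace.inner_single_right]
    ring
  unfold lapl
  simp only [h3]
  have hsum : ∑ i, (z i - p i) ^ 2 = ‖z - p‖ ^ 2 := by simp [EuclideanSpace.norm_sq_eq]
  rw [Finset.sum_add_distrib, ← Finset.mul_sum (f := fun i => (z i - p i) ^ 2), hsum, Finset.sum_const, Finset.card_univ,
    Fintype.card_fin, nsmul_eq_mul]
  ring

theorem lapl_inv_norm_nonpos {d : ℕ} (hd : 3 ≤ d) {p z : Euc d} (hz : z ≠ p) :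
    ContDiffAt ℝ 2 (fun x => (‖x - p‖ ^ 2) ^ (-(1 / 2) : ℝ)) z ∧
    lapl d (fun x => (‖x - p‖ ^ 2) ^ (-(1 / 2) : ℝ)) z ≤ 0 := by
  have hpos : 0 < ‖z - p‖ ^ 2 := by
    have := norm_pos_iff.2 (sub_ne_zero.2 hz)
    positivity
  refine ⟨(contDiff_normSq_sub p).contDiffAt.rpow_const_of_ne hpos.ne', ?_⟩
  rw [lapl_comp_normSq_sub (F := fun s => s ^ (-(1 / 2) : ℝ))
    (F₁ := fun s => (-(1 / 2) : ℝ) * s ^ (-(1 / 2) - 1 : ℝ))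
    ((lt_mem_nhds hpos).mono fun s hs => Real.hasDerivAt_rpow_const (Or.inl hs.ne'))
    ((Real.hasDerivAt_rpow_const (Or.inl hpos.ne')).const_mul _)]
  set s := ‖z - p‖ ^ 2
  have h1 : s * s ^ (-(1 / 2) - 1 - 1 : ℝ) = s ^ (-(1 / 2) - 1 : ℝ) := by
    rw [Real.rpow_sub_one hpos.ne' (-(1 / 2) - 1)]
    field_simp
  have h2 : 0 < s ^ (-(1 / 2) - 1 : ℝ) := Real.rpow_pos_of_pos hpos _
  have h3 : (3 : ℝ) ≤ d := by exact_mod_cast hd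
  calc 4 * s * (-(1 / 2) * ((-(1 / 2) - 1) * s ^ (-(1 / 2) - 1 - 1 : ℝ))) +
        2 * d * (-(1 / 2) * s ^ (-(1 / 2) - 1 : ℝ))
      = 3 * (s * s ^ (-(1 / 2) - 1 - 1 : ℝ)) - d * s ^ (-(1 / 2) - 1 : ℝ) := by ring
    _ ≤ 0 := by rw [h1]; nlinarith

variable {n : ℕ}

/-- The Newtonian-type barrier `a / |(x', |x_{n+1}| + a)|`. -/
def newtonBarrier (n : ℕ) (a : ℝ) (x : Euc (n + 1)) : ℝ :=
  a / √(‖thinProj n x‖ ^ 2 + (|x (Fin.last n)| + a) ^ 2)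

variable {a : ℝ}

theorem continuous_newtonBarrier (ha : 0 < a) : Continuous (newtonBarrier n a) := by
  have h := continuous_thinProj (n := n)
  unfold newtonBarrier
  refine Continuous.div continuous_const (by fun_prop) fun x => ?_
  positivity

theorem newtonBarrier_pos (ha : 0 < a) (x : Euc (n + 1)) : 0 < newtonBarrier n a x := by
  unfold newtonBarrier
  positivity

theorem newtonBarrier_le_div (ha : 0 < a) (x : Euc (n + 1)) :
    newtonBarrier n a x ≤ a / (|x (Fin.last n)| + a) := by
  unfold newtonBarrier
  gcongr
  refine Real.le_sqrt_of_sq_le ?_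
  linarith [sq_nonneg ‖thinProj n x‖]

theorem newtonBarrier_le_one (ha : 0 < a) (x : Euc (n + 1)) : newtonBarrier n a x ≤ 1 := by
  refine (newtonBarrier_le_div ha x).trans ?_
  rw [div_le_one (by positivity)]
  linarith [abs_nonneg (x (Fin.last n))]

theorem newtonBarrier_le_sub (ha : 0 < a) {x : Euc (n + 1)} (hx : |x (Fin.last n)| ≤ a) :
    newtonBarrier n a x ≤ 1 - |x (Fin.last n)| / (2 * a) := by
  refine (newtonBarrier_le_div ha x).trans ?_
  have h0 := abs_nonneg (x (Fin.last n))
  rw [div_le_iff₀ (by positivity)]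
  set y := |x (Fin.last n)|
  have : (1 - y / (2 * a)) * (y + a) = a + y * (a - y) / (2 * a) := by field_simp; ring
  rw [this]
  have : 0 ≤ y * (a - y) / (2 * a) := by
    have := sub_nonneg.2 hx
    positivity
  linarith

theorem le_newtonBarrier (ha : 0 < a) (x : Euc (n + 1)) :
    1 - ‖thinProj n x‖ ^ 2 / (2 * a ^ 2) - |x (Fin.last n)| / a ≤ newtonBarrier n a x := by
  unfold newtonBarrier
  set y := |x (Fin.last n)| with hy
  have h0 : 0 ≤ y := abs_nonneg (x (Fin.last n))
  set X := ‖thinProj n x‖ ^ 2 with hX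
  have hX0 : 0 ≤ X := sq_nonneg _
  have h1 : √(X + (y + a) ^ 2) ≤ a * (1 + (X / (2 * a ^ 2) + y / a)) := by
    refine Real.sqrt_le_iff.2 ⟨by positivity, ?_⟩
    have : a * (1 + (X / (2 * a ^ 2) + y / a)) = y + a + X / (2 * a) := by field_simp; ring
    rw [this]
    have h2 : (y + a + X / (2 * a)) ^ 2 = (y + a) ^ 2 + X + y * X / a + (X / (2 * a)) ^ 2 := by
      field_simp; ring
    rw [h2]
    have : 0 ≤ y * X / a := by positivity
    nlinarith [sq_nonneg (X / (2 * a))]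
  rw [le_div_iff₀ (by positivity)]
  set e := X / (2 * a ^ 2) + y / a
  have he : 0 ≤ e := by positivity
  have : 1 - X / (2 * a ^ 2) - y / a = 1 - e := by simp only [e]; ring
  rw [this]
  rcases le_total e 1 with h | h
  · calc (1 - e) * √(X + (y + a) ^ 2) ≤ (1 - e) * (a * (1 + e)) := by
          have := sub_nonneg.2 h
          gcongr
      _ ≤ a := by nlinarith [mul_nonneg ha.le (sq_nonneg e)]
  · have := mul_nonneg (sub_nonneg.2 h) (Real.sqrt_nonneg (X + (y + a) ^ 2))
    nlinarith

theorem compSuper_newtonBarrier (hn : 2 ≤ n) (ha : 0 < a) :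
    CompSuper (n + 1) (newtonBarrier n a) := by
  refine compSuper_of_touched_above (continuous_newtonBarrier ha) fun z => ?_
  obtain ⟨σ, hσ, hσz, hσle⟩ : ∃ σ : ℝ, σ ^ 2 = 1 ∧ |z (Fin.last n)| = σ * z (Fin.last n) ∧
      ∀ y, σ * y ≤ |y| := by
    rcases le_total 0 (z (Fin.last n)) with h | h
    · exact ⟨1, by norm_num, by rw [abs_of_nonneg h, one_mul],
        fun y => by rw [one_mul]; exact le_abs_self y⟩
    · exact ⟨-1, by norm_num, by rw [abs_of_nonpos h, neg_one_mul],
        fun y => by rw [neg_one_mul]; exact neg_le_abs y⟩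
  set p : Euc (n + 1) := thinEmbed n 0 (-(σ * a)) with hp
  have hnorm : ∀ x : Euc (n + 1), ‖x - p‖ ^ 2 =
      ‖thinProj n x‖ ^ 2 + (x (Fin.last n) + σ * a) ^ 2 := by
    intro x
    have : thinProj n (x - p) = thinProj n x := by
      ext i
      simp [thinProj_apply, hp, thinEmbed]
    rw [norm_sq_eq_thin, this, PiLp.sub_apply, hp, thinEmbed_last, sub_neg_eq_add]
  have hle : ∀ x : Euc (n + 1),
      ‖x - p‖ ^ 2 ≤ ‖thinProj n x‖ ^ 2 + (|x (Fin.last n)| + a) ^ 2 := by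
    intro x
    rw [hnorm, add_le_add_iff_left]
    have h1 := hσle (x (Fin.last n))
    have h2 := sq_abs (x (Fin.last n))
    have h3 : (x (Fin.last n) + σ * a) ^ 2 =
      |x (Fin.last n)| ^ 2 + 2 * a * (σ * x (Fin.last n)) + a ^ 2 := by
      rw [h2]; linear_combination a ^ 2 * hσ
    rw [h3]
    nlinarith
  have heq : ‖z - p‖ ^ 2 = ‖thinProj n z‖ ^ 2 + (|z (Fin.last n)| + a) ^ 2 := by
    rw [hnorm, hσz]
    linear_combination (a ^ 2 - z (Fin.last n) ^ 2) * hσ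
  have hzp : 0 < ‖z - p‖ ^ 2 := by rw [heq]; positivity
  have hne : z ≠ p := by
    rintro rfl
    simp at hzp
  have hrpow : ∀ s : ℝ, 0 ≤ s → s ^ (-(1 / 2) : ℝ) = (√s)⁻¹ := fun s hs => by
    rw [Real.rpow_neg hs, Real.sqrt_eq_rpow]
  obtain ⟨hc, hl⟩ := lapl_inv_norm_nonpos (d := n + 1) (by omega) hne
  refine ⟨fun x => a * (‖x - p‖ ^ 2) ^ (-(1 / 2) : ℝ), contDiffAt_const.mul hc, ?_, ?_, ?_⟩
  · simp only
    rw [hrpow _ (sq_nonneg _), heq, ← div_eq_mul_inv, newtonBarrier]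
  · have hcont : Continuous fun x : Euc (n + 1) => ‖x - p‖ ^ 2 := by fun_prop
    filter_upwards [hcont.continuousAt.eventually (lt_mem_nhds hzp)] with x hx
    rw [hrpow _ (sq_nonneg _), ← div_eq_mul_inv, newtonBarrier]
    have := Real.sqrt_pos.2 hx
    gcongr
    exact hle x
  · rw [lapl_const_mul a hc]
    exact mul_nonpos_of_nonneg_of_nonpos ha.le hl

theorem mem_frontier_cylinder {x₀ : Euc n} {r s : ℝ} {x : Euc (n + 1)}
    (hx : x ∈ frontier {x : Euc (n + 1) | ‖thinProj n x - x₀‖ < r ∧ |x (Fin.last n)| < s}) :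
    ‖thinProj n x - x₀‖ ≤ r ∧ |x (Fin.last n)| ≤ s ∧
      (‖thinProj n x - x₀‖ = r ∨ |x (Fin.last n)| = s) := by
  have hp := continuous_thinProj (n := n)
  have hc1 : Continuous fun x : Euc (n + 1) => ‖thinProj n x - x₀‖ := by fun_prop
  have hc2 : Continuous fun x : Euc (n + 1) => |x (Fin.last n)| := by fun_prop
  have ho : IsOpen {x : Euc (n + 1) | ‖thinProj n x - x₀‖ < r ∧ |x (Fin.last n)| < s} :=
    (isOpen_lt hc1 continuous_const).inter (isOpen_lt hc2 continuous_const)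
  have hcl : IsClosed {x : Euc (n + 1) | ‖thinProj n x - x₀‖ ≤ r ∧ |x (Fin.last n)| ≤ s} :=
    (isClosed_le hc1 continuous_const).inter (isClosed_le hc2 continuous_const)
  rw [ho.frontier_eq] at hx
  have h1 := closure_minimal (fun (y : Euc (n + 1)) (hy : ‖thinProj n y - x₀‖ < r ∧ |y (Fin.last n)| < s) =>
    (⟨hy.1.le, hy.2.le⟩ : ‖thinProj n y - x₀‖ ≤ r ∧ |y (Fin.last n)| ≤ s)) hcl hx.1
  refine ⟨h1.1, h1.2, ?_⟩
  by_contra! hc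
  exact hx.2 ⟨h1.1.lt_of_ne hc.1, h1.2.lt_of_ne hc.2⟩

theorem SlabData.leastSuper_le {ψ p : MvPolynomial (Fin n) ℝ} {ρ A t : ℝ}
    (h : SlabData ψ ρ A t) (hn : 2 ≤ n) (hψ : ∀ x', pev ψ x' ≤ pev p x')
    (hp : ∀ x', pev (polyLapl n p) x' ≤ 0) (ha : 0 < a) {K r s μ : ℝ} {x₀ : Euc n}
    (hK : 0 < K) (hr : 0 < r) (hs : 0 < s) (hsa : s ≤ a)
    (hpa : ∀ x', pev p x' ≤ 1 - ρ ^ 2 / (2 * a ^ 2))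
    (hA₁ : 1 / a ≤ A * t) (hA₂ : K * n * s ≤ A * t)
    (hμ : ∀ x', ‖x' - x₀‖ ≤ r → μ + K * n * s ^ 2 ≤ pev p x')
    (hμ₀ : 0 ≤ μ) (hμ₁ : 1 ≤ μ + K * r ^ 2) (hμ₂ : 1 - s / (2 * a) ≤ μ) :
    leastSuper (slabObstacle ψ A t) (thinEmbed n x₀ 0) ≤ pev p x₀ := by
  set Q := {x : Euc (n + 1) | ‖thinProj n x - x₀‖ < r ∧ |x (Fin.last n)| < s} with hQ
  set g : Euc (n + 1) → ℝ := pev (slabPoly n (p + K • sqDistPoly x₀) 0 (-(K * n))) with hg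
  have hgx : ∀ x : Euc (n + 1), g x = pev p (thinProj n x) + K * ‖thinProj n x - x₀‖ ^ 2 -
      K * n * x (Fin.last n) ^ 2 := by
    intro x
    rw [hg, pev_slabPoly, pev_add, ← pev_sqDistPoly]
    simp [pev]
    ring
  have hlg : ∀ x : Euc (n + 1), lapl (n + 1) g x ≤ 0 := by
    intro x
    rw [hg, lapl_slabPoly, polyLapl_add, polyLapl_smul, polyLapl_sqDistPoly, pev_add,
      MvPolynomial.smul_eq_C_mul, pev_mul, pev_C, pev_C]
    linarith [hp (thinProj n x)]
  have hKn : 0 ≤ K * n := by positivity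
  have hlow : ∀ x : Euc (n + 1), ‖thinProj n x - x₀‖ ≤ r → |x (Fin.last n)| ≤ s →
      μ + K * ‖thinProj n x - x₀‖ ^ 2 ≤ g x := by
    intro x h1 h2
    rw [hgx]
    have h3 : K * n * x (Fin.last n) ^ 2 ≤ K * n * s ^ 2 := by rw [← sq_abs]; gcongr
    linarith [hμ _ h1]
  have hp' := continuous_thinProj (n := n)
  have hQo : IsOpen Q := by
    have hc1 : Continuous fun x : Euc (n + 1) => ‖thinProj n x - x₀‖ := by fun_prop
    have hc2 : Continuous fun x : Euc (n + 1) => |x (Fin.last n)| := by fun_prop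
    exact (isOpen_lt hc1 continuous_const).inter (isOpen_lt hc2 continuous_const)
  have hfr : ∀ x ∈ frontier Q, newtonBarrier n a x ≤ g x := by
    intro x hx
    obtain ⟨h1, h2, h3⟩ := mem_frontier_cylinder hx
    have h4 := hlow x h1 h2
    rcases h3 with h3 | h3
    · rw [h3] at h4
      exact (newtonBarrier_le_one ha x).trans (hμ₁.trans h4)
    · have h5 := newtonBarrier_le_sub ha (h2.trans hsa)
      rw [h3] at h5
      have : 0 ≤ K * ‖thinProj n x - x₀‖ ^ 2 := by positivity
      linarith
  have hmem : glueMin Q (newtonBarrier n a) g ∈ superClass (slabObstacle ψ A t) := by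
    refine ⟨continuous_glueMin (continuous_newtonBarrier ha) (continuous_pev _) hfr,
      compSuper_glueMin hQo (compSuper_newtonBarrier hn ha) (contDiff_pev _)
        (fun x _ => hlg x) hfr, fun x => ?_⟩
    have hV0 := (newtonBarrier_pos ha x).le
    have hV : ‖thinProj n x‖ < ρ →
        pev ψ (thinProj n x) - A * t * |x (Fin.last n)| ≤ newtonBarrier n a x := by
      intro hx
      have h1 := le_newtonBarrier ha x
      have h2 : ‖thinProj n x‖ ^ 2 / (2 * a ^ 2) ≤ ρ ^ 2 / (2 * a ^ 2) := by gcongr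
      have h3 : |x (Fin.last n)| / a ≤ A * t * |x (Fin.last n)| := by
        rw [div_eq_inv_mul, ← one_div]
        gcongr
      linarith [hψ (thinProj n x), hpa (thinProj n x)]
    by_cases hx : x ∈ Q
    · rw [glueMin_of_mem _ _ hx]
      have hlx := hlow x hx.1.le hx.2.le
      have hKr : 0 ≤ K * ‖thinProj n x - x₀‖ ^ 2 := by positivity
      refine h.slabObstacle_le (le_min hV0 (by linarith)) fun h1 _ => le_min (hV h1) ?_
      rw [hgx]
      have h2 : K * n * x (Fin.last n) ^ 2 ≤ A * t * |x (Fin.last n)| := by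
        calc K * n * x (Fin.last n) ^ 2 = K * n * |x (Fin.last n)| * |x (Fin.last n)| := by
              rw [← sq_abs]; ring
          _ ≤ K * n * s * |x (Fin.last n)| := by have := hx.2.le; gcongr
          _ ≤ A * t * |x (Fin.last n)| := by gcongr
      linarith [hψ (thinProj n x)]
    · rw [glueMin_of_notMem _ _ hx]
      exact h.slabObstacle_le hV0 fun h1 _ => hV h1
  refine (_root_.leastSuper_le hmem _).trans ?_
  have hx₀ : thinEmbed n x₀ 0 ∈ Q := by
    simp [hQ, thinProj_thinEmbed, thinEmbed_last, hr, hs]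
  rw [glueMin_of_mem _ _ hx₀]
  refine (min_le_right _ _).trans_eq ?_
  rw [hgx]
  simp [thinProj_thinEmbed, thinEmbed_last]

end Barrier

section HarmonicExtension

variable {n : ℕ}

theorem polyLapl_C {d : ℕ} (c : ℝ) : polyLapl d (MvPolynomial.C c) = 0 := by
  simp [polyLapl]

theorem polyLapl_liftPoly_mul_pow (q : MvPolynomial (Fin n) ℝ) (k : ℕ) :
    polyLapl (n + 1) (liftPoly n q * MvPolynomial.X (Fin.last n) ^ (k + 2)) =
      liftPoly n (polyLapl n q) * MvPolynomial.X (Fin.last n) ^ (k + 2) +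
        ((k + 2) * (k + 1) : ℝ) • (liftPoly n q * MvPolynomial.X (Fin.last n) ^ k) := by
  have h1 : ∀ (q : MvPolynomial (Fin n) ℝ) (i : Fin n),
      MvPolynomial.pderiv i.castSucc (liftPoly n q * MvPolynomial.X (Fin.last n) ^ (k + 2)) =
        liftPoly n (MvPolynomial.pderiv i q) * MvPolynomial.X (Fin.last n) ^ (k + 2) := by
    intro q i
    rw [MvPolynomial.pderiv_mul, pderiv_castSucc_liftPoly, MvPolynomial.pderiv_pow,
      MvPolynomial.pderiv_X_of_ne (Fin.castSucc_lt_last i).ne', mul_zero, mul_zero, add_zero]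
  have h2 : ∀ j : ℕ, MvPolynomial.pderiv (Fin.last n)
      (liftPoly n q * MvPolynomial.X (Fin.last n) ^ (j + 1)) =
        ((j + 1 : ℝ)) • (liftPoly n q * MvPolynomial.X (Fin.last n) ^ j) := by
    intro j
    rw [MvPolynomial.pderiv_mul, pderiv_last_liftPoly, MvPolynomial.pderiv_pow,
      MvPolynomial.pderiv_X_self, MvPolynomial.smul_eq_C_mul]
    simp
    ring
  rw [polyLapl, Fin.sum_univ_castSucc]
  simp only [h1]
  rw [show k + 2 = (k + 1) + 1 from rfl, h2, Derivation.map_smul, h2, smul_smul]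
  congr 1
  · rw [← Finset.sum_mul]
    congr 1
    simp [polyLapl, liftPoly]
  · congr 1
    push_cast
    ring

/-- `R` is even in the last variable and vanishes on the thin space. -/
def EvenVanishing (R : MvPolynomial (Fin (n + 1)) ℝ) : Prop :=
  (∀ x' : Euc n, pev R (thinEmbed n x' 0) = 0) ∧
    ∀ (x' : Euc n) (t : ℝ), pev R (thinEmbed n x' t) = pev R (thinEmbed n x' (-t))

theorem exists_polyLapl_eq (N : ℕ) : ∀ (q : MvPolynomial (Fin n) ℝ), q.totalDegree ≤ N →
    ∀ j : ℕ, ∃ R : MvPolynomial (Fin (n + 1)) ℝ, EvenVanishing R ∧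
      polyLapl (n + 1) R = liftPoly n q * MvPolynomial.X (Fin.last n) ^ (2 * j) := by
  have key : ∀ (q : MvPolynomial (Fin n) ℝ) (j : ℕ) (R' : MvPolynomial (Fin (n + 1)) ℝ),
      EvenVanishing R' → polyLapl (n + 1) R' =
        liftPoly n (polyLapl n q) * MvPolynomial.X (Fin.last n) ^ (2 * (j + 1)) →
      ∃ R : MvPolynomial (Fin (n + 1)) ℝ, EvenVanishing R ∧
        polyLapl (n + 1) R = liftPoly n q * MvPolynomial.X (Fin.last n) ^ (2 * j) := by
    intro q j R' hR' hl
    have hc : (((2 * j : ℕ) : ℝ) + 2) * (((2 * j : ℕ) : ℝ) + 1) ≠ 0 := by positivity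
    refine ⟨((((2 * j : ℕ) : ℝ) + 2) * (((2 * j : ℕ) : ℝ) + 1))⁻¹ •
      (liftPoly n q * MvPolynomial.X (Fin.last n) ^ (2 * j + 2) - R'), ⟨fun x' => ?_,
        fun x' t => ?_⟩, ?_⟩
    · rw [MvPolynomial.smul_eq_C_mul, pev_mul, pev_sub, hR'.1, pev_mul]
      simp [pev, thinEmbed_last]
    · rw [MvPolynomial.smul_eq_C_mul, pev_mul, pev_mul, pev_sub, pev_sub, hR'.2 x' t, pev_mul,
        pev_mul, pev_liftPoly, pev_liftPoly, thinProj_thinEmbed, thinProj_thinEmbed, pev_C, pev_C]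
      have : Even (2 * j + 2) := ⟨j + 1, by ring⟩
      simp [pev, thinEmbed_last, this.neg_pow]
    · rw [polyLapl_smul, polyLapl_sub, polyLapl_liftPoly_mul_pow, hl,
        show 2 * (j + 1) = 2 * j + 2 from rfl, add_sub_cancel_left,
        smul_smul, inv_mul_cancel₀ hc, one_smul]
  induction N with
  | zero =>
    intro q hq j
    refine key q j 0 ⟨fun _ => by simp [pev], fun _ _ => by simp [pev]⟩ ?_
    rw [MvPolynomial.totalDegree_eq_zero_iff_eq_C.1 (Nat.le_zero.1 hq), polyLapl_C]
    simp [polyLapl, liftPoly]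
  | succ N ih =>
    intro q hq j
    obtain ⟨R', h1, h2⟩ := ih (polyLapl n q) (by have := totalDegree_polyLapl_le q; omega) (j + 1)
    exact key q j R' h1 h2

/-- Every polynomial on `ℝ^n` extends to an even harmonic polynomial on `ℝ^{n+1}`. -/
theorem exists_even_harmonic_extension (q : MvPolynomial (Fin n) ℝ) :
    ∃ P : MvPolynomial (Fin (n + 1)) ℝ, polyLapl (n + 1) P = 0 ∧
      (∀ x' : Euc n, pev P (thinEmbed n x' 0) = pev q x') ∧
      ∀ (x' : Euc n) (t : ℝ), pev P (thinEmbed n x' t) = pev P (thinEmbed n x' (-t)) := by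
  obtain ⟨R, hR, hl⟩ := exists_polyLapl_eq _ (polyLapl n q) le_rfl 0
  refine ⟨liftPoly n q - R, ?_, fun x' => ?_, fun x' t => ?_⟩
  · rw [polyLapl_sub, polyLapl_liftPoly, hl, mul_zero, pow_zero, mul_one, sub_self]
  · rw [pev_sub, pev_liftPoly, thinProj_thinEmbed, hR.1, sub_zero]
  · rw [pev_sub, pev_sub, pev_liftPoly, pev_liftPoly, thinProj_thinEmbed, thinProj_thinEmbed,
      hR.2 x' t]

theorem hasPolyGrowth_pev {d : ℕ} (p : MvPolynomial (Fin d) ℝ) : HasPolyGrowth d (pev p) := by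
  induction p using MvPolynomial.induction_on with
  | C a =>
    refine ⟨0, |a|, fun x => ?_⟩
    rw [pev_C]
    norm_num
    linarith [abs_nonneg a]
  | add p q hp hq =>
    obtain ⟨m₁, C₁, h₁⟩ := hp
    obtain ⟨m₂, C₂, h₂⟩ := hq
    refine ⟨m₁ + m₂, 2 * (|C₁| + |C₂|), fun x => ?_⟩
    have hpow : ∀ k l : ℕ, ‖x‖ ^ k ≤ 1 + ‖x‖ ^ (k + l) := by
      intro k l
      rcases le_total ‖x‖ 1 with h | h
      · have := pow_le_one₀ (n := k) (norm_nonneg x) h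
        have : 0 ≤ ‖x‖ ^ (k + l) := by positivity
        linarith
      · have := pow_le_pow_right₀ h (Nat.le_add_right k l)
        linarith
    have hb : ∀ (C : ℝ) (k l : ℕ), C * (1 + ‖x‖ ^ k) ≤ 2 * |C| * (1 + ‖x‖ ^ (k + l)) := by
      intro C k l
      have h0 : 0 ≤ ‖x‖ ^ (k + l) := by positivity
      calc C * (1 + ‖x‖ ^ k) ≤ |C| * (1 + ‖x‖ ^ k) := by gcongr; exact le_abs_self C
        _ ≤ |C| * (2 * (1 + ‖x‖ ^ (k + l))) := by gcongr; linarith [hpow k l]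
        _ = _ := by ring
    rw [pev_add]
    have e1 := (h₁ x).trans (hb C₁ m₁ m₂)
    have e2 := (h₂ x).trans (hb C₂ m₂ m₁)
    rw [add_comm m₂] at e2
    calc |pev p x + pev q x| ≤ |pev p x| + |pev q x| := abs_add_le _ _
      _ ≤ _ := by linarith
  | mul_X p i hp =>
    obtain ⟨m, C, h⟩ := hp
    refine ⟨m + 1, 2 * |C|, fun x => ?_⟩
    have hx : |x i| ≤ ‖x‖ := by simpa using PiLp.norm_apply_le x i
    have h1 : ‖x‖ * (1 + ‖x‖ ^ m) ≤ 2 * (1 + ‖x‖ ^ (m + 1)) := by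
      have h0 : 0 ≤ ‖x‖ ^ (m + 1) := by positivity
      rw [mul_add, mul_one, ← pow_succ']
      rcases le_total ‖x‖ 1 with h | h
      · linarith
      · have : ‖x‖ ≤ ‖x‖ ^ (m + 1) := le_self_pow₀ h (Nat.succ_ne_zero m)
        linarith
    have h2 : pev (MvPolynomial.X i) x = x i := by simp [pev]
    rw [pev_mul, abs_mul, h2]
    calc |pev p x| * |x i| ≤ (|C| * (1 + ‖x‖ ^ m)) * ‖x‖ := by
          gcongr
          refine (h x).trans ?_
          gcongr
          exact le_abs_self C
      _ = |C| * (‖x‖ * (1 + ‖x‖ ^ m)) := by ring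
      _ ≤ |C| * (2 * (1 + ‖x‖ ^ (m + 1))) := by gcongr
      _ = _ := by ring

theorem CompSuper.pev_add {d : ℕ} {w : Euc d → ℝ} (hw : CompSuper d w) {P : MvPolynomial (Fin d) ℝ}
    (hP : polyLapl d P = 0) : CompSuper d fun x => pev P x + w x := by
  intro z r hr h hh hl hs x hx
  have := hw z r hr (fun y => h y - pev P y) (hh.sub (contDiff_pev P)) (fun y hy => ?_)
    (fun y hy => by linarith [hs y hy]) x hx
  · linarith
  · rw [lapl_sub hh.contDiffAt (contDiff_pev P).contDiffAt, lapl_pev, hP]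
    simpa [pev] using hl y hy

end HarmonicExtension

section CapPoly

variable {n : ℕ}

/-- The radial polynomial `b - c |x|^{2 * k}`. -/
def capPoly (n : ℕ) (b c : ℝ) (k : ℕ) : MvPolynomial (Fin n) ℝ :=
  MvPolynomial.C b - MvPolynomial.C c * sqDistPoly 0 ^ k

theorem pev_capPoly (b c : ℝ) (k : ℕ) (x : Euc n) :
    pev (capPoly n b c k) x = b - c * (‖x‖ ^ 2) ^ k := by
  have h := pev_sqDistPoly 0 x
  rw [sub_zero] at h
  rw [← h]
  simp [capPoly, pev]

theorem pev_polyLapl_capPoly_nonpos (b : ℝ) {c : ℝ} (hc : 0 ≤ c) (k : ℕ) (x : Euc n) :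
    pev (polyLapl n (capPoly n b c k)) x ≤ 0 := by
  have hF : (pev (capPoly n b c k) : Euc n → ℝ) = fun y => (fun s => b - c * s ^ k) (‖y - 0‖ ^ 2) := by
    ext y
    simp [pev_capPoly]
  rw [← lapl_pev, hF, lapl_comp_normSq_sub (F₁ := fun s => -(c * (k * s ^ (k - 1))))
    (F₂ := -(c * (k * ((k - 1 : ℕ) * (‖x - 0‖ ^ 2) ^ (k - 1 - 1)))))
    (Eventually.of_forall fun s => ((hasDerivAt_pow k s).const_mul c).const_sub b)
    ((((hasDerivAt_pow (k - 1) _).const_mul (k : ℝ)).const_mul c).neg)]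
  have h1 : 0 ≤ 4 * ‖x - 0‖ ^ 2 * (c * (k * ((k - 1 : ℕ) * (‖x - 0‖ ^ 2) ^ (k - 1 - 1)))) := by
    positivity
  have h2 : 0 ≤ 2 * n * (c * (k * (‖x - 0‖ ^ 2) ^ (k - 1))) := by positivity
  linarith

end CapPoly

section Assembly

variable {n : ℕ}

theorem SlabData.exists_globalSolution {ψ : MvPolynomial (Fin n) ℝ} {ρ A t : ℝ}
    (h : SlabData ψ ρ A t) {x₁ : Euc n} (hx₁ : 0 < pev ψ x₁) :
    ∃ u : Euc (n + 1) → ℝ, IsGlobalSolution n (fun _ => 0) u ∧ HasPolyGrowth (n + 1) u ∧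
      contactSet n (fun _ => 0) u ⊆ thinSet n {x' | 0 < pev ψ x'} ∧
      ∀ x', leastSuper (slabObstacle ψ A t) (thinEmbed n x' 0) = pev ψ x' →
        thinEmbed n x' 0 ∈ contactSet n (fun _ => 0) u := by
  have hO := h.isObstacle
  set v := leastSuper (slabObstacle ψ A t) with hv
  have hpos : ∀ z, 0 < v z := by
    refine hO.leastSuper_pos (x₀ := thinEmbed n x₁ 0) ?_
    rw [slabObstacle_thinEmbed h.t_pos]
    exact lt_max_of_lt_right hx₁
  have hψv : ∀ x', pev ψ x' ≤ v (thinEmbed n x' 0) := by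
    intro x'
    refine le_trans ?_ (hO.le_leastSuper _)
    rw [slabObstacle_thinEmbed h.t_pos]
    exact le_max_right _ _
  obtain ⟨P, hP, hP₀, hPe⟩ := exists_even_harmonic_extension (-ψ)
  have hu₀ : ∀ x', pev P (thinEmbed n x' 0) + v (thinEmbed n x' 0) =
      v (thinEmbed n x' 0) - pev ψ x' := by
    intro x'
    rw [hP₀, pev_neg]
    ring
  have hcont : Continuous fun x => pev P x + v x := (continuous_pev P).add hO.continuous
  refine ⟨fun x => pev P x + v x, ⟨hcont, fun x' s => ?_, fun x' => ?_, ?_,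
    (hO.compSuper.pev_add hP).superMeanVal hcont⟩, ?_, fun x hx => ?_, fun x' hx' => ?_⟩
  · change pev P _ + v _ = pev P _ + v _
    rw [← hPe, ← coordReflection_thinEmbed, hv,
      hO.leastSuper_coordReflection slabObstacle_coordReflection]
  · change 0 ≤ pev P _ + v _
    rw [hu₀]
    exact sub_nonneg.2 (hψv x')
  · have key : ∀ x ∈ (contactSet n (fun _ => 0) fun x => pev P x + v x)ᶜ,
        ContDiffAt ℝ 2 v x ∧ lapl (n + 1) v x = 0 := by
      intro x hx
      refine hO.harmonicAt ?_
      by_cases hl : x (Fin.last n) = 0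
      · have hxe : x = thinEmbed n (thinProj n x) 0 := by
          rw [← hl, thinEmbed_thinProj]
        have hne : pev ψ (thinProj n x) ≠ v x := by
          intro hc
          refine hx ⟨hl, ?_⟩
          have h1 := hu₀ (thinProj n x)
          rw [← hxe] at h1
          change pev P x + v x = 0
          rw [h1, hc, sub_self]
        have h2 := hψv (thinProj n x)
        have h3 := slabObstacle_thinEmbed (ψ := ψ) (A := A) h.t_pos (thinProj n x)
        rw [← hxe] at h2 h3
        rw [h3]
        exact max_lt (hpos x) (h2.lt_of_ne hne)
      · exact h.lt_leastSuper hl (hpos x)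
    refine ⟨fun x hx => ((contDiff_pev P).contDiffAt.add (key x hx).1).contDiffWithinAt,
      fun x hx => ?_⟩
    rw [lapl_add (contDiff_pev P).contDiffAt (key x hx).1, (key x hx).2, lapl_pev, hP]
    simp [pev]
  · obtain ⟨m, C, hC⟩ := hasPolyGrowth_pev P
    refine ⟨m, C + 1, fun x => ?_⟩
    have h1 : |v x| ≤ 1 := abs_le.2 ⟨by linarith [hpos x], hO.leastSuper_le_one x⟩
    have h2 : 0 ≤ ‖x‖ ^ m := by positivity
    calc |pev P x + v x| ≤ |pev P x| + |v x| := abs_add_le _ _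
      _ ≤ C * (1 + ‖x‖ ^ m) + 1 := add_le_add (hC x) h1
      _ ≤ (C + 1) * (1 + ‖x‖ ^ m) := by linarith
  · obtain ⟨hl, hx0⟩ := hx
    have hxe : thinEmbed n (thinProj n x) 0 = x := by
      rw [← hl, thinEmbed_thinProj]
    refine ⟨thinProj n x, ?_, hxe⟩
    have h1 := hu₀ (thinProj n x)
    rw [hxe] at h1
    have h2 := hpos x
    change 0 < pev ψ (thinProj n x)
    change pev P x + v x = 0 at hx0
    linarith
  · refine ⟨thinEmbed_last _ _, ?_⟩
    change pev P _ + v _ = 0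
    rw [hu₀, hx', sub_self]

/-- The constant function `1` is a global solution with empty contact set. -/
theorem isGlobalSolution_one : IsGlobalSolution n (fun _ => 0) (fun _ => 1) := by
  refine ⟨continuous_const, fun _ _ => rfl, fun _ => zero_le_one,
    ⟨contDiffOn_const, fun x _ => lapl_const 1 x⟩,
    (compSuper_const 1).superMeanVal continuous_const⟩

theorem exists_mul_ge_one {f : MvPolynomial (Fin n) ℝ} (hf0 : ∀ x' : Euc n, 0 ≤ pev f x')
    {ρ ε : ℝ} (hε : 0 < ε) : ∃ N : ℝ, 0 ≤ N ∧ ∀ x' : Euc n, ‖x'‖ ≤ ρ →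
      ε ≤ infDist x' {y' : Euc n | pev f y' = 0} → 1 ≤ N * pev f x' := by
  set S : Set (Euc n) := closedBall 0 ρ ∩ {x' | ε ≤ infDist x' {y' : Euc n | pev f y' = 0}}
  have hS : IsCompact S := (isCompact_closedBall _ _).inter_right
    (isClosed_le continuous_const (continuous_infDist_pt _))
  have hpos : ∀ x' ∈ S, 0 < pev f x' := by
    intro x' hx'
    refine (hf0 x').lt_of_ne' fun h0 => ?_
    have h1 : ε ≤ infDist x' {y' : Euc n | pev f y' = 0} := hx'.2
    rw [infDist_zero_of_mem (show x' ∈ {y' : Euc n | pev f y' = 0} from h0)] at h1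
    linarith
  rcases S.eq_empty_or_nonempty with he | hne
  · refine ⟨0, le_rfl, fun x' h1 h2 => ?_⟩
    have : x' ∈ S := ⟨mem_closedBall_zero_iff.2 h1, h2⟩
    rw [he] at this
    exact absurd this (notMem_empty _)
  · obtain ⟨y, hy, hmin⟩ := hS.exists_isMinOn hne (continuous_pev f).continuousOn
    have hy0 := hpos y hy
    refine ⟨(pev f y)⁻¹, by positivity, fun x' h1 h2 => ?_⟩
    rw [← inv_mul_cancel₀ hy0.ne']
    have : pev f y ≤ pev f x' := hmin ⟨mem_closedBall_zero_iff.2 h1, h2⟩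
    gcongr

theorem exists_lower_bound (q : MvPolynomial (Fin n) ℝ) (ρ : ℝ) :
    ∃ M : ℝ, 0 ≤ M ∧ ∀ x' : Euc n, ‖x'‖ ≤ ρ → -M ≤ pev q x' := by
  obtain ⟨C, hC⟩ := (isCompact_closedBall (0 : Euc n) ρ).exists_bound_of_continuousOn
    (continuous_pev q).continuousOn
  refine ⟨|C|, abs_nonneg C, fun x' hx' => ?_⟩
  have h1 := hC x' (mem_closedBall_zero_iff.2 hx')
  rw [Real.norm_eq_abs] at h1
  linarith [neg_abs_le (pev q x'), le_abs_self C]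

end Assembly

/-- for `f ≥ 0` of degree `m ≥ 2` on `ℝ^n` and `ε > 0`, there is a global
solution with polynomial growth whose contact set contains `({f = 0} × {0}) ∩ B₁`
and is contained in an `ε`-neighborhood of `{f = 0}` intersected with `B_{1+ε}`. -/
theorem statement12 (n m : ℕ) (hn : 2 ≤ n) (hm : 2 ≤ m)
    (f : MvPolynomial (Fin n) ℝ)
    (hf0 : ∀ x' : EuclideanSpace ℝ (Fin n), 0 ≤ pev f x')
    (hfdeg : f.totalDegree = m) :
    ∀ ε > 0, ∃ u : EuclideanSpace ℝ (Fin (n + 1)) → ℝ,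
      IsGlobalSolution n (fun _ => 0) u ∧
      HasPolyGrowth (n + 1) u ∧
      thinSet n {x' | pev f x' = 0} ∩ Metric.closedBall 0 1 ⊆
        contactSet n (fun _ => 0) u ∧
      contactSet n (fun _ => 0) u ⊆
        thinSet n {x' | Metric.infDist x' {y' : EuclideanSpace ℝ (Fin n) |
          pev f y' = 0} ≤ ε} ∩ Metric.closedBall 0 (1 + ε) := by
  intro ε hε
  have hnorm : ∀ x' : Euc n, ‖thinEmbed n x' 0‖ = ‖x'‖ := by
    intro x'
    have h := norm_sq_eq_thin (thinEmbed n x' 0)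
    rw [thinProj_thinEmbed, thinEmbed_last, sq (0 : ℝ), mul_zero, add_zero] at h
    exact (sq_eq_sq₀ (norm_nonneg _) (norm_nonneg _)).1 h
  by_cases hz : ∃ x₁ : Euc n, pev f x₁ = 0 ∧ ‖x₁‖ ≤ 1
  swap
  · refine ⟨fun _ => 1, isGlobalSolution_one, ⟨0, 1, fun x => by norm_num⟩, ?_, ?_⟩
    · rintro _ ⟨⟨x', hx', rfl⟩, hb⟩
      refine absurd ⟨x', hx', ?_⟩ hz
      rw [← hnorm]
      exact mem_closedBall_zero_iff.1 hb
    · rintro x ⟨-, hx⟩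
      exact absurd hx one_ne_zero
  obtain ⟨x₁, hfx₁, hx₁⟩ := hz
  have hn0 : (0 : ℝ) < n := by
    have : 0 < n := by omega
    exact_mod_cast this
  set ρ : ℝ := 1 + ε with hρ
  have hρ0 : 0 < ρ := by positivity
  set r : ℝ := ε / 2 with hr
  have hr0 : 0 < r := by positivity
  set a : ℝ := 1 + 4 * ρ ^ 2 + 48 * n * ρ ^ 4 / r ^ 2 with ha
  have ha0 : 0 < a := by positivity
  have haM : 4 * ρ ^ 2 + 48 * n * ρ ^ 4 / r ^ 2 ≤ a ^ 2 := by
    have h0 : 0 ≤ 4 * ρ ^ 2 + 48 * n * ρ ^ 4 / r ^ 2 := by positivity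
    have h1 : 1 + (4 * ρ ^ 2 + 48 * n * ρ ^ 4 / r ^ 2) = a := by rw [ha]; ring
    rw [← h1]
    nlinarith
  set η : ℝ := ρ ^ 2 / (2 * a ^ 2) with hη
  have hη0 : 0 < η := by positivity
  have hη1 : 3 * η ≤ 1 := by
    have h0 : 0 ≤ 48 * n * ρ ^ 4 / r ^ 2 := by positivity
    rw [hη, mul_div_assoc', div_le_one (by positivity)]
    nlinarith
  set K : ℝ := 1 / (32 * n * ρ ^ 2) with hK
  have hK0 : 0 < K := by positivity
  set s : ℝ := 4 * ρ ^ 2 / a with hs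
  have hs0 : 0 < s := by positivity
  have hsa : s ≤ a := by
    have h0 : 0 ≤ 48 * n * ρ ^ 4 / r ^ 2 := by positivity
    rw [hs, div_le_iff₀ ha0]
    nlinarith
  have hKs : K * n * s ^ 2 = η := by
    rw [hK, hs, hη]
    field_simp
    norm_num
  have hKr : 3 * η ≤ K * r ^ 2 := by
    have h1 : 48 * n * ρ ^ 4 / r ^ 2 ≤ a ^ 2 := by
      have : 0 ≤ 4 * ρ ^ 2 := by positivity
      linarith
    rw [div_le_iff₀ (by positivity)] at h1
    rw [hη, hK, mul_div_assoc', div_mul_eq_mul_div, one_mul,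
      div_le_div_iff₀ (by positivity) (by positivity)]
    nlinarith
  have hsη : 3 * η ≤ s / (2 * a) := by
    have h1 : s / (2 * a) = 4 * η := by
      rw [hs, hη]
      field_simp
    linarith
  obtain ⟨k, hk⟩ : ∃ k : ℕ, (((1 + r) / ρ) ^ 2) ^ k < η := by
    refine exists_pow_lt_of_lt_one hη0 ?_
    have : (1 + r) / ρ < 1 := by
      rw [div_lt_one hρ0]
      linarith
    exact pow_lt_one₀ (by positivity) this two_ne_zero
  set c : ℝ := ((ρ ^ 2)⁻¹) ^ k with hc
  have hc0 : 0 < c := by positivity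
  set p := capPoly n (1 - η) c k with hp
  have hpx : ∀ x' : Euc n, pev p x' = 1 - η - (‖x'‖ ^ 2 / ρ ^ 2) ^ k := by
    intro x'
    rw [hp, pev_capPoly, hc, ← mul_pow, ← div_eq_inv_mul]
  have hple : ∀ x' : Euc n, pev p x' ≤ 1 - η := by
    intro x'
    rw [hpx]
    have : 0 ≤ (‖x'‖ ^ 2 / ρ ^ 2) ^ k := by positivity
    linarith
  have hp1 : ∀ x' : Euc n, ‖x'‖ ≤ 1 + r → 1 - 2 * η ≤ pev p x' := by
    intro x' hx'
    rw [hpx]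
    have : (‖x'‖ ^ 2 / ρ ^ 2) ^ k ≤ (((1 + r) / ρ) ^ 2) ^ k := by
      rw [← div_pow]
      gcongr
    linarith
  have hpρ : ∀ x' : Euc n, ρ ≤ ‖x'‖ → pev p x' ≤ -η := by
    intro x' hx'
    rw [hpx]
    have : 1 ≤ (‖x'‖ ^ 2 / ρ ^ 2) ^ k := by
      refine one_le_pow₀ ?_
      rw [one_le_div (by positivity)]
      gcongr
    linarith
  obtain ⟨N, hN0, hN⟩ := exists_mul_ge_one hf0 (ρ := ρ) hε
  set ψ := p - N • f with hψ
  have hψx : ∀ x' : Euc n, pev ψ x' = pev p x' - N * pev f x' := by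
    intro x'
    rw [hψ, pev_sub, MvPolynomial.smul_eq_C_mul, pev_mul, pev_C]
  have hψp : ∀ x' : Euc n, pev ψ x' ≤ pev p x' := by
    intro x'
    rw [hψx]
    have := mul_nonneg hN0 (hf0 x')
    linarith
  have hψ0 : ∀ x' : Euc n, pev f x' = 0 → pev ψ x' = pev p x' := by
    intro x' hx'
    rw [hψx, hx', mul_zero, sub_zero]
  obtain ⟨M, hM0, hM⟩ := exists_lower_bound (polyLapl n ψ) ρ
  set A : ℝ := 1 + M + 1 / a + K * n * s with hA
  have hA1 : 0 < 1 / a := by positivity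
  have hA2 : 0 < K * n * s := by positivity
  have hS : SlabData ψ ρ A 1 :=
    { t_pos := one_pos
      height := by linarith
      lapl_ge := fun x' hx' => by linarith [hM x' hx']
      le_one := fun x' => by linarith [hψp x', hple x']
      nonpos := fun x' hx' => by linarith [hψp x', hpρ x' hx'] }
  obtain ⟨u, hu, hug, hcon, hcon'⟩ := hS.exists_globalSolution (x₁ := x₁) (by
    rw [hψ0 _ hfx₁]
    linarith [hp1 x₁ (by linarith)])
  refine ⟨u, hu, hug, ?_, ?_⟩
  · rintro _ ⟨⟨x₀, hx₀, rfl⟩, hb⟩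
    have hx₀1 : ‖x₀‖ ≤ 1 := by
      rw [← hnorm]
      exact mem_closedBall_zero_iff.1 hb
    refine hcon' x₀ (le_antisymm ?_ ?_)
    · rw [hψ0 x₀ hx₀]
      refine hS.leastSuper_le hn hψp (pev_polyLapl_capPoly_nonpos _ hc0.le k) ha0 hK0 hr0 hs0 hsa
        hple (by linarith) (by linarith) (μ := 1 - 3 * η) (fun x' hx' => ?_) (by linarith)
        (by linarith) (by linarith)
      have h1 : ‖x'‖ ≤ 1 + r := by
        have := norm_le_norm_add_norm_sub' x' x₀
        linarith
      rw [hKs]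
      linarith [hp1 x' h1]
    · refine le_trans ?_ (hS.isObstacle.le_leastSuper _)
      rw [slabObstacle_thinEmbed hS.t_pos]
      exact le_max_right _ _
  · intro x hx
    obtain ⟨x', hx', rfl⟩ := hcon hx
    have h0 : 0 < pev ψ x' := hx'
    have hlt : ‖x'‖ < ρ := by
      by_contra! hge
      linarith [hS.nonpos x' hge]
    refine ⟨⟨x', ?_, rfl⟩, ?_⟩
    · change infDist x' {y' : Euc n | pev f y' = 0} ≤ ε
      by_contra! hge
      have h1 := hN x' hlt.le hge.le
      have h2 := hψx x'
      linarith [hple x']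
    · rw [mem_closedBall_zero_iff, hnorm]
      exact hlt.le

end
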